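/- arXiv:1311.0557 — 7 statements merged into one kernel-verified Lean document; each statement's English description precedes it below -/
import Mathlib

section
/- Let K ∈ A_𝔎 satisfy det K ≠ 0 and ord(det K) = r. Then K is invertible as a matrix over ℂ((ε)) and ε·K⁻¹ ∈ A_𝔏; that is, K⁻¹ has at most a simple pole at ε = 0 and its residue matrix lies in 𝔏. -/
open Matrix

noncomputable section

/-- The field `ℂ((ε))` of formal Laurent series over `ℂ`. -/
abbrev LS : Type := LaurentSeries ℂ

/-- Index type for `N × N` matrices in `2 × 2` block form, `N = r + s` with `s = N - r`. -/
abbrev Idx (r s : ℕ) : Type := Fin r ⊕ Fin s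

/-- The complex matrix of coefficients of `ε^k` of a matrix of Laurent series. -/
def coeffM {r s : ℕ} (M : Matrix (Idx r s) (Idx r s) LS) (k : ℤ) :
    Matrix (Idx r s) (Idx r s) ℂ :=
  Matrix.of fun i j => (M i j).coeff k

/-- `M ∈ A`: every entry of `M` is a power series (no negative coefficients). -/
def memA {r s : ℕ} (M : Matrix (Idx r s) (Idx r s) LS) : Prop :=
  ∀ i j, ∀ k : ℤ, k < 0 → (M i j).coeff k = 0

/-- `X ∈ 𝔎`: complex matrices whose first `r` rows vanish. -/
def memK {r s : ℕ} (X : Matrix (Idx r s) (Idx r s) ℂ) : Prop :=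
  ∀ (i : Fin r) (j : Idx r s), X (Sum.inl i) j = 0

/-- `X ∈ 𝔏`: complex matrices whose last `N - r` columns vanish. -/
def memL {r s : ℕ} (X : Matrix (Idx r s) (Idx r s) ℂ) : Prop :=
  ∀ (i : Idx r s) (j : Fin s), X i (Sum.inr j) = 0

/-- `M ∈ A_𝔎`: `M ∈ A` and `M|_{ε=0} ∈ 𝔎`. -/
def memAK {r s : ℕ} (M : Matrix (Idx r s) (Idx r s) LS) : Prop :=
  memA M ∧ memK (coeffM M 0)

/-- `M ∈ A_𝔏`: `M ∈ A` and `M|_{ε=0} ∈ 𝔏`. -/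
def memAL {r s : ℕ} (M : Matrix (Idx r s) (Idx r s) LS) : Prop :=
  memA M ∧ memL (coeffM M 0)

/-- The Laurent series `ε`. -/
def eps : LS := HahnSeries.single (1 : ℤ) (1 : ℂ)

/-- A constant complex matrix viewed as a matrix of Laurent series. -/
def constM {r s : ℕ} (X : Matrix (Idx r s) (Idx r s) ℂ) :
    Matrix (Idx r s) (Idx r s) LS :=
  X.map (algebraMap ℂ LS)

/-- If `K ∈ A_𝔎` with `det K ≠ 0` and `ord (det K) = r`, then `K` is
invertible over `ℂ((ε))` and `ε·K⁻¹ ∈ A_𝔏`: `K⁻¹` has at most a simple pole at `ε = 0`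
and its residue matrix lies in `𝔏`. -/
theorem AK_inverse_simple_pole (r s : ℕ) (hr : 0 < r) (hs : 0 < s)
    (K : Matrix (Idx r s) (Idx r s) LS) (hK : memAK K)
    (hdet : K.det ≠ 0) (hord : K.det.order = (r : ℤ)) :
    IsUnit K.det ∧ memAL (eps • K⁻¹) := by
  have hU : IsUnit K.det := isUnit_iff_ne_zero.mpr hdet
  refine ⟨hU, ?_⟩
  obtain ⟨hA, hK0⟩ := hK
  let φ : PowerSeries ℂ →+* LS := HahnSeries.ofPowerSeries ℤ ℂ
  have hnn : ∀ (f : PowerSeries ℂ) (k : ℤ), k < 0 → (φ f).coeff k = 0 := by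
    intro f k hk
    have := PowerSeries.coeff_coe f k
    rw [if_pos hk] at this
    exact this
  have hco : ∀ (f : PowerSeries ℂ) (n : ℕ), (φ f).coeff (n : ℤ) = PowerSeries.coeff n f := by
    intro f n
    exact HahnSeries.ofPowerSeries_apply_coeff f n
  have hem : ∀ (f : LS) (k : ℤ), (eps * f).coeff k = f.coeff (k - 1) := by
    intro f k
    have := HahnSeries.coeff_single_mul_add (r := (1:ℂ)) (x := f) (a := k - 1) (b := (1:ℤ))
    simpa [eps] using this
  let P : Matrix (Idx r s) (Idx r s) (PowerSeries ℂ) := Matrix.of fun i j =>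
    PowerSeries.mk fun n => (K i j).coeff ((n : ℤ) + Sum.elim (fun _ => (1:ℤ)) (fun _ => 0) i)
  let d : Idx r s → LS := Sum.elim (fun _ => eps) (fun _ => 1)
  let e : Idx r s → LS := Sum.elim (fun _ => 1) (fun _ => eps)
  have hKP : K = diagonal d * φ.mapMatrix P := by
    ext i j k
    rw [diagonal_mul]
    rcases i with i | i
    · simp only [d, Sum.elim_inl, hem, RingHom.mapMatrix_apply, map_apply]
      rcases lt_trichotomy k 0 with hk | hk | hk
      · rw [hnn _ _ (by omega), hA _ _ _ hk]
      · subst hk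
        rw [hnn _ _ (by omega)]
        exact hK0 i j
      · obtain ⟨n, hn⟩ := Int.eq_ofNat_of_zero_le (show 0 ≤ k - 1 by omega)
        rw [hn, hco]
        simp only [P, of_apply, PowerSeries.coeff_mk, Sum.elim_inl]
        congr 1; omega
    · simp only [d, Sum.elim_inr, one_mul, RingHom.mapMatrix_apply, map_apply]
      rcases lt_or_ge k 0 with hk | hk
      · rw [hnn _ _ hk, hA _ _ _ hk]
      · obtain ⟨n, rfl⟩ := Int.eq_ofNat_of_zero_le hk
        rw [hco]
        simp [P]
  have hdetK : K.det = eps ^ r * φ P.det := by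
    rw [hKP, det_mul, det_diagonal, ← RingHom.map_det]
    simp [d]
  have hpow : ∀ (n : ℕ) (f : LS), (eps ^ n * f).coeff n = f.coeff 0 := by
    intro n
    induction n with
    | zero => intro f; simp
    | succ n ih =>
      intro f
      rw [pow_succ', mul_assoc, hem, ← ih f]
      congr 1; push_cast; ring
  have hc : PowerSeries.constantCoeff P.det ≠ 0 := by
    have h1 : K.det.coeff (r : ℤ) ≠ 0 := by
      rw [← hord]; exact HahnSeries.coeff_order_eq_zero.not.2 hdet
    rw [hdetK, hpow] at h1
    have := hco P.det 0
    rw [Nat.cast_zero] at this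
    rw [this] at h1
    simpa using h1
  have hPu : IsUnit P.det := by
    rw [PowerSeries.isUnit_iff_constantCoeff]
    exact isUnit_iff_ne_zero.mpr hc
  have hQP : P⁻¹ * P = 1 := nonsing_inv_mul P hPu
  have hde : diagonal e * diagonal d = Matrix.scalar (Idx r s) eps := by
    rw [diagonal_mul_diagonal, Matrix.scalar_apply]
    congr 1
    ext1 i
    rcases i with i | i <;> simp [d, e]
  have hL : φ.mapMatrix P⁻¹ * diagonal e * K = Matrix.scalar (Idx r s) eps := by
    conv_lhs => rw [hKP]
    calc _ = φ.mapMatrix P⁻¹ * (diagonal e * diagonal d) * φ.mapMatrix P := by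
          simp only [Matrix.mul_assoc]
      _ = _ := by
          rw [hde, ← (Matrix.scalar_commute eps (fun x => mul_comm _ _) (φ.mapMatrix P⁻¹)).eq,
            Matrix.mul_assoc, ← map_mul φ.mapMatrix, hQP, map_one, Matrix.mul_one]
  have hfin : eps • K⁻¹ = φ.mapMatrix P⁻¹ * diagonal e := by
    calc eps • K⁻¹ = Matrix.scalar (Idx r s) eps * K⁻¹ := by
          ext1 i j
          rw [Matrix.scalar_apply, diagonal_mul, Matrix.smul_apply]
          rfl
      _ = _ := by rw [← hL, Matrix.mul_assoc _ K, mul_nonsing_inv K hU, Matrix.mul_one]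
  rw [hfin]
  constructor
  · intro i j k hk
    rw [mul_diagonal, mul_comm]
    rcases j with j | j
    · simpa [e] using hnn _ k hk
    · simp only [e, Sum.elim_inr, hem]
      exact hnn _ _ (by omega)
  · intro i j
    simp only [coeffM, of_apply]
    rw [mul_diagonal, mul_comm]
    simp only [e, Sum.elim_inr, hem]
    exact hnn _ _ (by omega)
end
end

section
/- Let L be an N×N matrix over ℂ((ε)) such that ε·L ∈ A_𝔏, det L ≠ 0 and ord(det L) = −r. Then L is invertible over ℂ((ε)) and L⁻¹ ∈ A_𝔎. -/
open Matrix

noncomputable section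

theorem exists_ps (x : LS) (h : ∀ k : ℤ, k < 0 → x.coeff k = 0) :
    ∃ p : PowerSeries ℂ, HahnSeries.ofPowerSeries ℤ ℂ p = x := by
  refine ⟨PowerSeries.mk fun n => x.coeff n, ?_⟩
  ext i
  rw [PowerSeries.coeff_coe]
  split_ifs with hi
  · rw [h i hi]
  · rw [PowerSeries.coeff_mk]
    congr 1
    omega

theorem coeff_eps_mul (x : LS) (k : ℤ) : (eps * x).coeff k = x.coeff (k - 1) := by
  unfold eps
  rw [HahnSeries.coeff_single_mul, one_mul]

/-- If `L` is a matrix over `ℂ((ε))` with `ε·L ∈ A_𝔏`, `det L ≠ 0` and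
`ord (det L) = −r`, then `L` is invertible over `ℂ((ε))` and `L⁻¹ ∈ A_𝔎`. -/
theorem AL_pole_inverse_in_AK (r s : ℕ) (hr : 0 < r) (hs : 0 < s)
    (L : Matrix (Idx r s) (Idx r s) LS) (hL : memAL (eps • L))
    (hdet : L.det ≠ 0) (hord : L.det.order = -(r : ℤ)) :
    IsUnit L.det ∧ memAK L⁻¹ := by
  have hU : IsUnit L.det := isUnit_iff_ne_zero.mpr hdet
  refine ⟨hU, ?_⟩
  obtain ⟨hA, hLL⟩ := hL
  let d : Idx r s → LS := Sum.elim (fun _ => eps) (fun _ => 1)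
  have hP : ∀ i j, ∃ p : PowerSeries ℂ,
      HahnSeries.ofPowerSeries ℤ ℂ p = (L * Matrix.diagonal d) i j := by
    intro i j
    apply exists_ps
    intro k hk
    rw [Matrix.mul_diagonal]
    rcases j with j | j
    · have := hA i (Sum.inl j) k hk
      rw [Matrix.smul_apply, smul_eq_mul] at this
      simpa [d, mul_comm] using this
    · simp only [d, Sum.elim_inr, mul_one]
      have key : (eps * L i (Sum.inr j)).coeff (k + 1) = 0 := by
        rcases lt_or_eq_of_le (show k + 1 ≤ 0 by omega) with h | h
        · have := hA i (Sum.inr j) (k + 1) h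
          rwa [Matrix.smul_apply, smul_eq_mul] at this
        · have := hLL i j
          rw [h]
          simpa [coeffM, Matrix.smul_apply, smul_eq_mul] using this
      rw [coeff_eps_mul] at key
      simpa using key
  choose q hq using hP
  let Q : Matrix (Idx r s) (Idx r s) (PowerSeries ℂ) := Matrix.of q
  have hQ : (HahnSeries.ofPowerSeries ℤ ℂ).mapMatrix Q = L * Matrix.diagonal d := by
    ext1 i j
    exact hq i j
  have hdd : (Matrix.diagonal d).det = HahnSeries.single (r : ℤ) (1 : ℂ) := by
    rw [Matrix.det_diagonal, Fintype.prod_sum_type]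
    simp [d, eps, HahnSeries.single_pow]
  have hdQ : HahnSeries.ofPowerSeries ℤ ℂ Q.det = L.det * HahnSeries.single (r : ℤ) (1 : ℂ) := by
    rw [RingHom.map_det, hQ, Matrix.det_mul, hdd]
  have hQU : IsUnit Q.det := by
    rw [PowerSeries.isUnit_iff_constantCoeff, isUnit_iff_ne_zero]
    intro h0
    have h1 := congrArg (fun x : LS => x.coeff 0) hdQ
    simp only [PowerSeries.coeff_coe, HahnSeries.coeff_mul_single] at h1
    apply hdet
    rw [← HahnSeries.coeff_order_eq_zero, hord]
    simpa [h0] using h1.symm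
  have hinv : L⁻¹ = Matrix.diagonal d * (HahnSeries.ofPowerSeries ℤ ℂ).mapMatrix Q⁻¹ := by
    apply Matrix.inv_eq_right_inv
    rw [← mul_assoc, ← hQ, ← map_mul, Matrix.mul_nonsing_inv _ hQU, map_one]
  rw [hinv]
  have hneg : ∀ (p : PowerSeries ℂ) (k : ℤ), k < 0 →
      (HahnSeries.ofPowerSeries ℤ ℂ p).coeff k = 0 := by
    intro p k hk
    rw [PowerSeries.coeff_coe, if_pos hk]
  constructor
  · intro i j k hk
    rw [Matrix.diagonal_mul]
    rcases i with i | i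
    · simp only [d, Sum.elim_inl]
      rw [coeff_eps_mul]
      exact hneg _ _ (by omega)
    · simp only [d, Sum.elim_inr, one_mul]
      exact hneg _ _ hk
  · intro i j
    simp only [coeffM, Matrix.of_apply]
    rw [Matrix.diagonal_mul]
    simp only [d, Sum.elim_inl]
    rw [coeff_eps_mul]
    exact hneg _ _ (by omega)
end
end

section
/- Let K ∈ A_𝔎 with block expansion K = [[0,0],[C₀,D₀]] + [[A₁,B₁],[C₁,D₁]]·ε + O(ε²) (so the complex matrices A₁,B₁ are the ε-coefficients of the top blocks and C₀,D₀ the constant terms of the bottom blocks). Then the coefficient of ε^j in det K vanishes for all j < r, and the coefficient of ε^r in det K equals det [[A₁,B₁],[C₀,D₀]]; in other words det K = ε^r·det [[A₁,B₁],[C₀,D₀]] + O(ε^{r+1}). -/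
open Matrix

noncomputable section

/-- The complex matrix `[[A₁,B₁],[C₀,D₀]]`: top `r` rows are the `ε¹`-coefficients and
bottom `N−r` rows the `ε⁰`-coefficients of `K`. -/
def mixK {r s : ℕ} (K : Matrix (Idx r s) (Idx r s) LS) : Matrix (Idx r s) (Idx r s) ℂ :=
  Matrix.of fun i j =>
    match i with
    | Sum.inl i' => (K (Sum.inl i') j).coeff 1
    | Sum.inr i' => (K (Sum.inr i') j).coeff 0

/-- For `K ∈ A_𝔎`, the coefficient of `ε^j` in `det K` vanishes for
`j < r`, and the coefficient of `ε^r` equals `det [[A₁,B₁],[C₀,D₀]]`. -/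
theorem det_AK_leading_coefficient (r s : ℕ) (hr : 0 < r) (hs : 0 < s)
    (K : Matrix (Idx r s) (Idx r s) LS) (hK : memAK K) :
    (∀ j : ℤ, j < (r : ℤ) → K.det.coeff j = 0) ∧
    K.det.coeff (r : ℤ) = (mixK K).det := by
  obtain ⟨hA, hB⟩ := hK
  let w : Idx r s → ℕ := Sum.elim (fun _ => 1) (fun _ => 0)
  let P : Matrix (Idx r s) (Idx r s) (PowerSeries ℂ) :=
    Matrix.of fun i j => PowerSeries.mk fun n => (K i j).coeff ((n : ℤ) + (w i : ℤ))
  have hlow : ∀ i j, ∀ k : ℤ, k < (w i : ℤ) → (K i j).coeff k = 0 := by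
    intro i j k hk
    rcases i with i | i
    · have hk1 : k < 1 := by simpa [w] using hk
      rcases lt_or_eq_of_le (show k ≤ 0 by omega) with h | h
      · exact hA _ _ _ h
      · subst h
        exact hB i j
    · exact hA _ _ _ (by simpa [w] using hk)
  have hKP : K = Matrix.of fun i j => (HahnSeries.single ((w i : ℕ) : ℤ) (1 : ℂ) : LS) *
      ((HahnSeries.ofPowerSeries ℤ ℂ).mapMatrix P) i j := by
    ext i j k
    simp only [Matrix.of_apply, RingHom.mapMatrix_apply, Matrix.map_apply]
    rw [HahnSeries.coeff_single_mul, one_mul, PowerSeries.coeff_coe]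
    split_ifs with h
    · exact hlow i j k (by omega)
    · simp only [P, Matrix.of_apply, PowerSeries.coeff_mk]
      congr 1
      omega
  have hprod : (∏ i, (HahnSeries.single ((w i : ℕ) : ℤ) (1 : ℂ) : LS))
      = HahnSeries.single (r : ℤ) (1 : ℂ) := by
    simp [w, Fintype.prod_sum_type, HahnSeries.single_pow]
  have hdet : K.det = HahnSeries.single (r : ℤ) (1 : ℂ) *
      (HahnSeries.ofPowerSeries ℤ ℂ P.det) := by
    rw [hKP, Matrix.det_mul_column, hprod, ← RingHom.map_det]
  refine ⟨fun j hj => ?_, ?_⟩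
  · rw [hdet, HahnSeries.coeff_single_mul, PowerSeries.coeff_coe, if_pos (by omega), mul_zero]
  · rw [hdet, HahnSeries.coeff_single_mul, PowerSeries.coeff_coe, if_neg (by omega), one_mul]
    simp only [sub_self, Int.natAbs_zero, PowerSeries.coeff_zero_eq_constantCoeff]
    rw [RingHom.map_det]
    congr 1
    ext i j
    rcases i with i | i <;>
      simp [P, w, mixK, ← PowerSeries.coeff_zero_eq_constantCoeff_apply]
end
end

section
/- Assume β_{m−1} ∈ A and β_m ∈ A_𝔎 with ord(det β_m) = r, det D_{m,0} ≠ 0, and additionally det Z1 ≠ 0 and det Z2 ≠ 0. Denote by [[A_{m+k,0},B_{m+k,0}],[C_{m+k,0},D_{m+k,0}]] the block decomposition of the ε⁰-coefficient of the dPI iterate β_{m+k}. Then: (i) D_{m+1,0} + D_{m,0}⁻¹·C_{m,0}·B_{m+1,0} = Z1; (ii) D_{m+2,0} + D_{m,0}⁻¹·C_{m,0}·B_{m+2,0} = Z2; (iii) D_{m+3,0} = Z3 = D_{m,0} − (m+1)·Z1⁻¹ + (m+2)·Z2⁻¹; that is, the matrices Z1, Z2, Z3 are expressible purely in terms of the initial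 data β_{m−1}, β_m, α. -/
open Matrix

noncomputable section

/-- `D_{M,k}` : the `(2,2)` block (size `(N−r) × (N−r)`) of the `ε^k`-coefficient. -/
def Dblk {r s : ℕ} (M : Matrix (Idx r s) (Idx r s) LS) (k : ℤ) : Matrix (Fin s) (Fin s) ℂ :=
  (coeffM M k).toBlocks₂₂

/-- `C_{M,k}` : the `(2,1)` block (size `(N−r) × r`) of the `ε^k`-coefficient. -/
def Cblk {r s : ℕ} (M : Matrix (Idx r s) (Idx r s) LS) (k : ℤ) : Matrix (Fin s) (Fin r) ℂ :=
  (coeffM M k).toBlocks₂₁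

/-- `B_{M,k}` : the `(1,2)` block (size `r × (N−r)`) of the `ε^k`-coefficient. -/
def Bblk {r s : ℕ} (M : Matrix (Idx r s) (Idx r s) LS) (k : ℤ) : Matrix (Fin r) (Fin s) ℂ :=
  (coeffM M k).toBlocks₁₂

/-- `A_{M,k}` : the `(1,1)` block (size `r × r`) of the `ε^k`-coefficient. -/
def Ablk {r s : ℕ} (M : Matrix (Idx r s) (Idx r s) LS) (k : ℤ) : Matrix (Fin r) (Fin r) ℂ :=
  (coeffM M k).toBlocks₁₁

/-- The leading Schur complement `S₁ = A_{m,1} − B_{m,1}·D_{m,0}⁻¹·C_{m,0}` of `β_m`. -/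
def S1 {r s : ℕ} (βm : Matrix (Idx r s) (Idx r s) LS) : Matrix (Fin r) (Fin r) ℂ :=
  Ablk βm 1 - Bblk βm 1 * (Dblk βm 0)⁻¹ * Cblk βm 0

/-- `Z₁ := m·D_{m,0}⁻¹ − D_{m−1,0} − D_{m,0} − α₂₂ − D_{m,0}⁻¹·C_{m,0}·(B_{m−1,0} + α₁₂)`. -/
def Z1 {r s : ℕ} (m : ℕ) (βprev βm : Matrix (Idx r s) (Idx r s) LS)
    (α : Matrix (Idx r s) (Idx r s) ℂ) : Matrix (Fin s) (Fin s) ℂ :=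
  (m : ℂ) • (Dblk βm 0)⁻¹ - Dblk βprev 0 - Dblk βm 0 - α.toBlocks₂₂
    - (Dblk βm 0)⁻¹ * Cblk βm 0 * (Bblk βprev 0 + α.toBlocks₁₂)

/-- `Z₂ := (m+1)·Z₁⁻¹ + D_{m,0}⁻¹·C_{m,0}·B_{m−1,0} − m·D_{m,0}⁻¹ + D_{m−1,0}`. -/
def Z2 {r s : ℕ} (m : ℕ) (βprev βm : Matrix (Idx r s) (Idx r s) LS)
    (α : Matrix (Idx r s) (Idx r s) ℂ) : Matrix (Fin s) (Fin s) ℂ :=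
  ((m : ℂ) + 1) • (Z1 m βprev βm α)⁻¹ + (Dblk βm 0)⁻¹ * Cblk βm 0 * Bblk βprev 0
    - (m : ℂ) • (Dblk βm 0)⁻¹ + Dblk βprev 0

/-- `Z₃ := D_{m,0} − (m+1)·Z₁⁻¹ + (m+2)·Z₂⁻¹`. -/
def Z3 {r s : ℕ} (m : ℕ) (βprev βm : Matrix (Idx r s) (Idx r s) LS)
    (α : Matrix (Idx r s) (Idx r s) ℂ) : Matrix (Fin s) (Fin s) ℂ :=
  Dblk βm 0 - ((m : ℂ) + 1) • (Z1 m βprev βm α)⁻¹ + ((m : ℂ) + 2) • (Z2 m βprev βm α)⁻¹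

abbrev PS : Type := PowerSeries ℂ

abbrev phi : PS →+* LS := HahnSeries.ofPowerSeries ℤ ℂ

abbrev psi : PS →+* ℂ := PowerSeries.constantCoeff (R := ℂ)

lemma phi_X : phi PowerSeries.X = eps := by
  simp [phi, eps]

lemma eps_ne : eps ≠ 0 := by
  simp [eps]

lemma coeff_phi (f : PS) : (phi f).coeff 0 = psi f := by
  have := HahnSeries.ofPowerSeries_apply_coeff (Γ := ℤ) f 0
  simpa using this

lemma phi_C (z : ℂ) : phi (PowerSeries.C z) = algebraMap ℂ LS z := by
  rw [HahnSeries.algebraMap_apply']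
  rfl

lemma coeff_alg (z : ℂ) (x : LS) (k : ℤ) : (algebraMap ℂ LS z * x).coeff k = z * x.coeff k := by
  have : algebraMap ℂ LS z = HahnSeries.C z := by
    rw [← phi_C]; exact HahnSeries.ofPowerSeries_C z
  rw [this, HahnSeries.C_mul_eq_smul, HahnSeries.coeff_smul, smul_eq_mul]

lemma exists_phi (x : LS) (h : ∀ k : ℤ, k < 0 → x.coeff k = 0) : ∃ f : PS, x = phi f := by
  refine ⟨PowerSeries.mk fun n => x.coeff n, ?_⟩
  ext k
  rcases lt_or_ge k 0 with hk | hk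
  · rw [h k hk]
    symm
    apply HahnSeries.embDomain_of_notMem_range
    rintro ⟨n, hn⟩
    simp at hn
    omega
  · lift k to ℕ using hk
    have := HahnSeries.ofPowerSeries_apply_coeff (Γ := ℤ) (PowerSeries.mk fun n => x.coeff n) k
    simpa using this.symm

def RegAt {r s : ℕ} (M : Matrix (Idx r s) (Idx r s) LS) (W0 : Matrix (Idx r s) (Idx r s) ℂ) : Prop :=
  ∃ W : Matrix (Idx r s) (Idx r s) PS, M = W.map phi ∧ W.map psi = W0

def Polar {r s : ℕ} (M : Matrix (Idx r s) (Idx r s) LS) (a0 : Matrix (Fin r) (Fin r) ℂ)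
    (z0 : Matrix (Fin s) (Fin s) ℂ) : Prop :=
  ∃ (a : Matrix (Fin r) (Fin r) PS) (b : Matrix (Fin r) (Fin s) PS)
    (c : Matrix (Fin s) (Fin r) PS) (z : Matrix (Fin s) (Fin s) PS),
    M = fromBlocks (eps⁻¹ • a.map phi) (b.map phi) (c.map phi) (z.map phi) ∧
    a.map psi = a0 ∧ z.map psi = z0

section
variable {r s : ℕ}

lemma reg_of_memA {M : Matrix (Idx r s) (Idx r s) LS} (h : memA M) : RegAt M (coeffM M 0) := by
  choose f hf using fun i j => exists_phi (M i j) (h i j)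
  refine ⟨Matrix.of f, ?_, ?_⟩
  · ext1 i j; simp [hf]
  · ext1 i j
    simp only [coeffM, Matrix.map_apply, Matrix.of_apply]
    rw [hf i j, coeff_phi]

lemma RegAt.coeffM {M : Matrix (Idx r s) (Idx r s) LS} {W0} (h : RegAt M W0) : coeffM M 0 = W0 := by
  obtain ⟨W, rfl, rfl⟩ := h
  ext i j
  simp only [_root_.coeffM, Matrix.map_apply, Matrix.of_apply]
  rw [coeff_phi]

lemma reg_const (α : Matrix (Idx r s) (Idx r s) ℂ) : RegAt (constM α) α := by
  refine ⟨α.map PowerSeries.C, ?_, ?_⟩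
  · ext1 i j
    simp only [constM, Matrix.map_apply]
    rw [phi_C]
  · ext i j; simp [psi]

lemma RegAt.add {M N : Matrix (Idx r s) (Idx r s) LS} {U V} (h : RegAt M U) (h' : RegAt N V) :
    RegAt (M + N) (U + V) := by
  obtain ⟨W, rfl, rfl⟩ := h
  obtain ⟨W', rfl, rfl⟩ := h'
  exact ⟨W + W', by ext1 i j; simp, by ext1 i j; simp⟩

lemma RegAt.sub {M N : Matrix (Idx r s) (Idx r s) LS} {U V} (h : RegAt M U) (h' : RegAt N V) :
    RegAt (M - N) (U - V) := by
  obtain ⟨W, rfl, rfl⟩ := h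
  obtain ⟨W', rfl, rfl⟩ := h'
  exact ⟨W - W', by ext1 i j; simp, by ext1 i j; simp⟩

lemma RegAt.smul {M : Matrix (Idx r s) (Idx r s) LS} {U} (n : ℕ) (h : RegAt M U) :
    RegAt ((n : LS) • M) ((n : ℂ) • U) := by
  obtain ⟨W, rfl, rfl⟩ := h
  exact ⟨(n : PS) • W, by ext1 i j; simp, by ext1 i j; simp⟩

lemma Polar.sub_reg {M N : Matrix (Idx r s) (Idx r s) LS} {a0 z0 V} (h : Polar M a0 z0)
    (h' : RegAt N V) : Polar (M - N) a0 (z0 - V.toBlocks₂₂) := by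
  obtain ⟨a, b, c, z, rfl, rfl, rfl⟩ := h
  obtain ⟨W, rfl, rfl⟩ := h'
  refine ⟨a - (PowerSeries.X : PS) • W.toBlocks₁₁, b - W.toBlocks₁₂, c - W.toBlocks₂₁,
    z - W.toBlocks₂₂, ?_, ?_, ?_⟩
  · ext1 i j
    rcases i with i | i <;> rcases j with j | j
    · simp only [Matrix.sub_apply, fromBlocks_apply₁₁, Matrix.smul_apply, Matrix.map_apply,
        map_sub, smul_eq_mul, map_mul, phi_X, toBlocks₁₁, Matrix.of_apply]
      field_simp [eps_ne]
    · simp [toBlocks₁₂]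
    · simp [toBlocks₂₁]
    · simp [toBlocks₂₂]
  · ext1 i j; simp
  · ext1 i j; simp [toBlocks₂₂]

lemma Polar.smul {M : Matrix (Idx r s) (Idx r s) LS} {a0 z0} (n : ℕ) (h : Polar M a0 z0) :
    Polar ((n : LS) • M) ((n : ℂ) • a0) ((n : ℂ) • z0) := by
  obtain ⟨a, b, c, z, rfl, rfl, rfl⟩ := h
  refine ⟨(n : PS) • a, (n : PS) • b, (n : PS) • c, (n : PS) • z, ?_, ?_, ?_⟩
  · ext1 i j
    rcases i with i | i <;> rcases j with j | j <;> simp [mul_left_comm]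
  · ext1 i j; simp
  · ext1 i j; simp

lemma Polar.neg {M : Matrix (Idx r s) (Idx r s) LS} {a0 z0} (h : Polar M a0 z0) :
    Polar (-M) (-a0) (-z0) := by
  obtain ⟨a, b, c, z, rfl, rfl, rfl⟩ := h
  refine ⟨-a, -b, -c, -z, ?_, ?_, ?_⟩
  · ext1 i j
    rcases i with i | i <;> rcases j with j | j
    · simp only [Matrix.neg_apply, fromBlocks_apply₁₁, Matrix.smul_apply, Matrix.map_apply,
        map_neg, smul_eq_mul]
      exact (mul_neg (eps⁻¹ : LS) (phi (a i j))).symm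
    · simp
    · simp
    · simp
  · ext1 i j; simp
  · ext1 i j; simp

lemma Polar.D {M : Matrix (Idx r s) (Idx r s) LS} {a0 z0} (h : Polar M a0 z0) :
    Dblk M 0 = z0 := by
  obtain ⟨a, b, c, z, rfl, rfl, rfl⟩ := h
  ext i j
  simp only [Dblk, coeffM, toBlocks₂₂, Matrix.of_apply, fromBlocks_apply₂₂, Matrix.map_apply]
  rw [coeff_phi]

lemma exists_X {n k : ℕ} (c : Matrix (Fin n) (Fin k) PS) (h : c.map psi = 0) :
    ∃ c' : Matrix (Fin n) (Fin k) PS, c = (PowerSeries.X : PS) • c' := by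
  have : ∀ i j, ∃ f : PS, c i j = PowerSeries.X * f := by
    intro i j
    have h1 : psi (c i j) = 0 := congrFun (congrFun h i) j
    exact PowerSeries.X_dvd_iff.mpr h1
  choose f hf using this
  exact ⟨Matrix.of f, by ext1 i j; simp [hf]⟩

lemma smulL {l n k : Type*} [Fintype n] (e : LS) (A : Matrix l n LS) (B : Matrix n k LS) :
    (e • A) * B = e • (A * B) := by
  ext1 i j
  simp only [Matrix.mul_apply, Matrix.smul_apply, smul_eq_mul, Finset.mul_sum, mul_assoc]

lemma smulR {l n k : Type*} [Fintype n] (e : LS) (A : Matrix l n LS) (B : Matrix n k LS) :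
    A * (e • B) = e • (A * B) := by
  ext1 i j
  simp only [Matrix.mul_apply, Matrix.smul_apply, smul_eq_mul, Finset.mul_sum, mul_left_comm]

lemma smulI {l n : Type*} (A : Matrix l n LS) : eps⁻¹ • (eps • A) = A := by
  ext1 i j
  simp only [Matrix.smul_apply, smul_eq_mul]
  exact inv_mul_cancel_left₀ eps_ne _

lemma smulI2 {l n : Type*} (A : Matrix l n LS) : eps • (eps⁻¹ • A) = A := by
  ext1 i j
  simp only [Matrix.smul_apply, smul_eq_mul]
  exact mul_inv_cancel_left₀ eps_ne _

/-- inverse of the regular part -/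
lemma inv_Y (a : Matrix (Fin r) (Fin r) PS) (b : Matrix (Fin r) (Fin s) PS)
    (c : Matrix (Fin s) (Fin r) PS) (z : Matrix (Fin s) (Fin s) PS)
    (ha : (a.map psi).det ≠ 0) (hz : (z.map psi).det ≠ 0) :
    ∃ (a' : Matrix (Fin r) (Fin r) PS) (b' : Matrix (Fin r) (Fin s) PS)
      (c' : Matrix (Fin s) (Fin r) PS) (z' : Matrix (Fin s) (Fin s) PS),
      fromBlocks a b ((PowerSeries.X : PS) • c) z *
        fromBlocks a' b' ((PowerSeries.X : PS) • c') z' = 1 ∧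
      a'.map psi = (a.map psi)⁻¹ ∧ z'.map psi = (z.map psi)⁻¹ := by
  set Y := fromBlocks a b ((PowerSeries.X : PS) • c) z with hY
  have hX0 : ((PowerSeries.X : PS) • c).map psi = 0 := by ext1 i j; simp
  have hY0 : Y.map psi = fromBlocks (a.map psi) (b.map psi) 0 (z.map psi) := by
    rw [hY, fromBlocks_map, hX0]
  have hdet : IsUnit Y.det := by
    rw [PowerSeries.isUnit_iff_constantCoeff]
    have : psi Y.det = (Y.map psi).det := RingHom.map_det psi Y
    rw [this, hY0, det_fromBlocks_zero₂₁]
    exact (mul_ne_zero ha hz).isUnit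
  have hmul : Y * Y⁻¹ = 1 := mul_nonsing_inv Y hdet
  have hmul0 : Y.map psi * (Y⁻¹).map psi = 1 := by
    rw [← Matrix.map_mul, hmul]; exact Matrix.map_one _ (map_zero _) (map_one _)
  set V := Y⁻¹ with hV
  have hVb : V = fromBlocks V.toBlocks₁₁ V.toBlocks₁₂ V.toBlocks₂₁ V.toBlocks₂₂ :=
    (fromBlocks_toBlocks V).symm
  rw [hY0, hVb, fromBlocks_map, fromBlocks_multiply, ← fromBlocks_one, fromBlocks_inj] at hmul0
  obtain ⟨e1, e2, e3, e4⟩ := hmul0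
  rw [Matrix.zero_mul, zero_add] at e3 e4
  have hzu : IsUnit (z.map psi).det := hz.isUnit
  have e3' : V.toBlocks₂₁.map psi = 0 := by
    have := congrArg ((z.map psi)⁻¹ * ·) e3
    simpa [← Matrix.mul_assoc, nonsing_inv_mul _ hzu] using this
  rw [e3', Matrix.mul_zero, add_zero] at e1
  obtain ⟨c', hc'⟩ := exists_X _ e3'
  refine ⟨V.toBlocks₁₁, V.toBlocks₁₂, c', V.toBlocks₂₂, ?_, ?_, ?_⟩
  · rw [← hc', fromBlocks_toBlocks]; exact hmul
  · exact (inv_eq_right_inv e1).symm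
  · exact (inv_eq_right_inv e4).symm

lemma Polar.inv {M : Matrix (Idx r s) (Idx r s) LS} {a0 z0} (h : Polar M a0 z0)
    (ha : a0.det ≠ 0) (hz : z0.det ≠ 0) : RegAt M⁻¹ (fromBlocks 0 0 0 z0⁻¹) := by
  obtain ⟨a, b, c, z, rfl, rfl, rfl⟩ := h
  obtain ⟨a', b', c', z', hm, -, hz'⟩ := inv_Y a b c z ha hz
  refine ⟨fromBlocks ((PowerSeries.X : PS) • a') ((PowerSeries.X : PS) • b')
    ((PowerSeries.X : PS) • c') z', ?_, ?_⟩
  · apply inv_eq_right_inv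
    have hm' := congrArg (fun W => W.map phi) hm
    simp only [Matrix.map_mul] at hm'
    rw [Matrix.map_one _ (map_zero _) (map_one _)] at hm'
    rw [← hm']
    have sm : ∀ {n k : ℕ} (q : Matrix (Fin n) (Fin k) PS),
        ((PowerSeries.X : PS) • q).map phi = eps • q.map phi := by
      intro n k q; ext1 i j
      simp only [Matrix.map_apply, Matrix.smul_apply, smul_eq_mul, map_mul, phi_X]
    simp only [fromBlocks_map, fromBlocks_multiply, sm, smulL, smulR, smulI, smulI2, smul_add]
  · rw [fromBlocks_map, hz']
    congr 1 <;> (ext1 i j; simp)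

lemma inv_P {P : Matrix (Idx r s) (Idx r s) LS} {D : Matrix (Fin s) (Fin s) ℂ}
    (h : RegAt P (fromBlocks 0 0 0 D)) (hD : D.det ≠ 0) (h0 : P.det ≠ 0)
    (ho : P.det.order = (r : ℤ)) : ∃ a0, a0.det ≠ 0 ∧ Polar P⁻¹ a0 D⁻¹ := by
  obtain ⟨W, rfl, hW⟩ := h
  rw [← fromBlocks_toBlocks W, fromBlocks_map, fromBlocks_inj] at hW
  obtain ⟨e1, e2, e3, rfl⟩ := hW
  obtain ⟨a, ha⟩ := exists_X _ e1
  obtain ⟨b, hb⟩ := exists_X _ e2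
  obtain ⟨c, hc⟩ := exists_X _ e3
  set z := W.toBlocks₂₂ with hz
  have hWe : W = fromBlocks ((PowerSeries.X : PS) • (1 : Matrix (Fin r) (Fin r) PS)) 0 0 1 *
      fromBlocks a b ((PowerSeries.X : PS) • c) z := by
    rw [← fromBlocks_toBlocks W, ha, hb, hc, fromBlocks_multiply]
    simp [hz]
  have hdet : W.det = PowerSeries.X ^ r * (fromBlocks a b ((PowerSeries.X : PS) • c) z).det := by
    conv_lhs => rw [hWe]
    rw [det_mul, det_fromBlocks_zero₂₁]
    simp [det_smul]
  have hmd : (W.map phi).det = phi W.det := (RingHom.map_det phi W).symm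
  have hpsi : psi (fromBlocks a b ((PowerSeries.X : PS) • c) z).det ≠ 0 := by
    intro h
    obtain ⟨g, hg⟩ := PowerSeries.X_dvd_iff.mpr h
    have : (W.map phi).det.coeff (r : ℤ) = 0 := by
      rw [hmd, hdet, hg]
      have := HahnSeries.ofPowerSeries_apply_coeff (Γ := ℤ) (PowerSeries.X ^ r * (PowerSeries.X * g)) r
      refine (by simpa using this : _ = _).trans ?_
      rw [PowerSeries.coeff_X_pow_mul']
      simp
    rw [← ho] at this
    exact h0 (HahnSeries.coeff_order_eq_zero.mp this)
  have hd2 : psi (fromBlocks a b ((PowerSeries.X : PS) • c) z).det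
      = (a.map psi).det * (z.map psi).det := by
    have h1 : psi (fromBlocks a b ((PowerSeries.X : PS) • c) z).det = ((fromBlocks a b ((PowerSeries.X : PS) • c) z).map psi).det := RingHom.map_det psi _
    have hX0 : ((PowerSeries.X : PS) • c).map psi = 0 := by ext1 i j; simp
    rw [h1, fromBlocks_map, hX0, det_fromBlocks_zero₂₁]
  have ha0 : (a.map psi).det ≠ 0 := fun h => hpsi (by rw [hd2, h, zero_mul])
  obtain ⟨a', b', c', z', hm, ha', hz'⟩ := inv_Y a b c z ha0 hD
  refine ⟨(a.map psi)⁻¹, ?_, a', b', c', z', ?_, ha', hz'⟩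
  · rw [det_nonsing_inv, Ring.inverse_eq_inv']
    exact inv_ne_zero ha0
  · apply inv_eq_left_inv
    have hm2 := mul_eq_one_comm.mp hm
    have hm' := congrArg (fun W => W.map phi) hm2
    simp only [Matrix.map_mul] at hm'
    rw [Matrix.map_one _ (map_zero _) (map_one _)] at hm'
    have sm : ∀ {n k : ℕ} (q : Matrix (Fin n) (Fin k) PS),
        ((PowerSeries.X : PS) • q).map phi = eps • q.map phi := by
      intro n k q; ext1 i j
      simp only [Matrix.map_apply, Matrix.smul_apply, smul_eq_mul, map_mul, phi_X]
    rw [← hm', ← fromBlocks_toBlocks W, ha, hb, hc]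
    simp only [fromBlocks_map, fromBlocks_multiply, sm, smulL, smulR, smulI, smulI2, smul_add]
    rfl

lemma core (m : ℕ) (hm : 2 ≤ m)
    (α : Matrix (Idx r s) (Idx r s) ℂ)
    (βprev βm β1 β2 β3 : Matrix (Idx r s) (Idx r s) LS) (E : Matrix (Idx r s) (Idx r s) ℂ)
    (D z1 z2 : Matrix (Fin s) (Fin s) ℂ)
    (hprev : RegAt βprev E) (hβm : RegAt βm (fromBlocks 0 0 0 D))
    (hd0 : βm.det ≠ 0) (hdm : βm.det.order = (r : ℤ))
    (hD : D.det ≠ 0) (hZ1 : z1.det ≠ 0) (hZ2 : z2.det ≠ 0)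
    (hz1 : z1 = (m : ℂ) • D⁻¹ - E.toBlocks₂₂ - D - α.toBlocks₂₂)
    (hz2 : z2 = ((m : ℂ) + 1) • z1⁻¹ - (m : ℂ) • D⁻¹ + E.toBlocks₂₂)
    (h1 : β1 = (m : LS) • βm⁻¹ - βprev - βm - constM α)
    (h2 : β2 = ((m : LS) + 1) • β1⁻¹ - βm - β1 - constM α)
    (h3 : β3 = ((m : LS) + 2) • β2⁻¹ - β1 - β2 - constM α) :
    Dblk β1 0 = z1 ∧ Dblk β2 0 = z2 ∧
    coeffM β3 0 = fromBlocks 0 0 0 (D - ((m : ℂ) + 1) • z1⁻¹ + ((m : ℂ) + 2) • z2⁻¹) := by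
  obtain ⟨a0, ha0, hP⟩ := inv_P hβm hD hd0 hdm
  have hm0 : (m : ℂ) ≠ 0 := by exact_mod_cast (by omega : m ≠ 0)
  have f1 : Polar β1 ((m : ℂ) • a0) z1 := by
    have := (((hP.smul m).sub_reg hprev).sub_reg hβm).sub_reg (reg_const α)
    rw [← h1] at this
    rw [toBlocks_fromBlocks₂₂] at this
    rw [hz1]; exact this
  have d1 : ((m : ℂ) • a0).det ≠ 0 := by
    rw [det_smul]; exact mul_ne_zero (pow_ne_zero _ hm0) ha0
  have r1 := (f1.inv d1 hZ1).smul (m + 1)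
  have f2 : Polar β2 (-((m : ℂ) • a0)) z2 := by
    have := (f1.sub_reg ((r1.sub hβm).sub (reg_const α))).neg
    convert this using 1
    · rw [h2]; push_cast; abel
    · rw [hz2]
      have : ((((m + 1 : ℕ) : ℂ) • (fromBlocks 0 0 0 z1⁻¹ : Matrix (Idx r s) (Idx r s) ℂ) -
        fromBlocks 0 0 0 D - α)).toBlocks₂₂ = ((m : ℂ) + 1) • z1⁻¹ - D - α.toBlocks₂₂ := by
        ext i j; simp [toBlocks₂₂]
      rw [this]
      nth_rw 2 [hz1]
      abel
  have d2 : (-((m : ℂ) • a0)).det ≠ 0 := by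
    rw [det_neg]; exact mul_ne_zero (pow_ne_zero _ (by norm_num)) d1
  have r2 := (f2.inv d2 hZ2).smul (m + 2)
  have r3 := (r2.sub r1).add hβm
  have e3 : β3 = ((m + 2 : ℕ) : LS) • β2⁻¹ - ((m + 1 : ℕ) : LS) • β1⁻¹ + βm := by
    have : β1 + β2 + constM α = ((m : LS) + 1) • β1⁻¹ - βm := by rw [h2]; abel
    have h3' : β3 = ((m : LS) + 2) • β2⁻¹ - (β1 + β2 + constM α) := by rw [h3]; abel
    rw [h3', this]; push_cast; abel
  rw [← e3] at r3
  refine ⟨f1.D, f2.D, ?_⟩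
  rw [r3.coeffM]
  ext i j
  rcases i with i | i <;> rcases j with j | j <;> simp
  ring

lemma coeffM_const_mul (T : Matrix (Idx r s) (Idx r s) ℂ) (M : Matrix (Idx r s) (Idx r s) LS)
    (k : ℤ) : coeffM (constM T * M) k = T * coeffM M k := by
  ext i j
  simp only [coeffM, constM, Matrix.mul_apply, HahnSeries.coeff_sum, Matrix.of_apply,
    Matrix.map_apply, coeff_alg]

lemma coeffM_mul_const (T : Matrix (Idx r s) (Idx r s) ℂ) (M : Matrix (Idx r s) (Idx r s) LS)
    (k : ℤ) : coeffM (M * constM T) k = coeffM M k * T := by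
  ext i j
  simp only [coeffM, constM, Matrix.mul_apply, HahnSeries.coeff_sum, Matrix.of_apply,
    Matrix.map_apply]
  refine Finset.sum_congr rfl fun x _ => ?_
  rw [mul_comm, coeff_alg, mul_comm]

lemma RegAt.mul {M N : Matrix (Idx r s) (Idx r s) LS} {U V} (h : RegAt M U) (h' : RegAt N V) :
    RegAt (M * N) (U * V) := by
  obtain ⟨W, rfl, rfl⟩ := h
  obtain ⟨W', rfl, rfl⟩ := h'
  exact ⟨W * W', by rw [Matrix.map_mul], by rw [Matrix.map_mul]⟩

lemma constM_mul (S T : Matrix (Idx r s) (Idx r s) ℂ) : constM (S * T) = constM S * constM T := by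
  simp only [constM, Matrix.map_mul]

lemma constM_one : constM (1 : Matrix (Idx r s) (Idx r s) ℂ) = 1 := by
  simp only [constM]
  exact Matrix.map_one _ (map_zero _) (map_one _)

end

/-- Under the standing hypotheses (with `det D_{m,0} ≠ 0`,
`det Z₁ ≠ 0`, `det Z₂ ≠ 0`), the blocks of the constant terms of the dPI iterates
satisfy `D_{m+1,0} + D_{m,0}⁻¹·C_{m,0}·B_{m+1,0} = Z₁`,
`D_{m+2,0} + D_{m,0}⁻¹·C_{m,0}·B_{m+2,0} = Z₂` and
`D_{m+3,0} = Z₃ = D_{m,0} − (m+1)·Z₁⁻¹ + (m+2)·Z₂⁻¹`; so `Z₁, Z₂, Z₃` are expressible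
purely in terms of the initial data `β_{m−1}, β_m, α`. -/
theorem Z_matrices_from_initial_data (r s m : ℕ) (hr : 0 < r) (hs : 0 < s) (hm : 2 ≤ m)
    (α : Matrix (Idx r s) (Idx r s) ℂ)
    (βprev βm β1 β2 β3 : Matrix (Idx r s) (Idx r s) LS)
    (hprev : memA βprev) (hβm : memAK βm)
    (hdm : βm.det ≠ 0 ∧ βm.det.order = (r : ℤ))
    (hD : (Dblk βm 0).det ≠ 0)
    (hZ1 : (Z1 m βprev βm α).det ≠ 0)
    (hZ2 : (Z2 m βprev βm α).det ≠ 0)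
    (h1 : β1 = (m : LS) • βm⁻¹ - βprev - βm - constM α)
    (h2 : β2 = ((m : LS) + 1) • β1⁻¹ - βm - β1 - constM α)
    (h3 : β3 = ((m : LS) + 2) • β2⁻¹ - β1 - β2 - constM α) :
    Dblk β1 0 + (Dblk βm 0)⁻¹ * Cblk βm 0 * Bblk β1 0 = Z1 m βprev βm α ∧
    Dblk β2 0 + (Dblk βm 0)⁻¹ * Cblk βm 0 * Bblk β2 0 = Z2 m βprev βm α ∧
    Dblk β3 0 = Z3 m βprev βm α ∧
    Z3 m βprev βm α =
      Dblk βm 0 - ((m : ℂ) + 1) • (Z1 m βprev βm α)⁻¹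
        + ((m : ℂ) + 2) • (Z2 m βprev βm α)⁻¹ := by
  set H := (Dblk βm 0)⁻¹ * Cblk βm 0 with hH
  have hDu : IsUnit (Dblk βm 0).det := hD.isUnit
  have hDH : Dblk βm 0 * H = Cblk βm 0 := by
    rw [hH, ← Matrix.mul_assoc, mul_nonsing_inv _ hDu, Matrix.one_mul]
  set T : Matrix (Idx r s) (Idx r s) ℂ := fromBlocks 1 0 H 1 with hT
  set T' : Matrix (Idx r s) (Idx r s) ℂ := fromBlocks 1 0 (-H) 1 with hT'
  have hTT : T * T' = 1 := by
    rw [hT, hT', fromBlocks_multiply]; simp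
  have hTT2 : T' * T = 1 := mul_eq_one_comm.mp hTT
  have cTT : constM T * constM T' = 1 := by rw [← constM_mul, hTT, constM_one]
  have cTT2 : constM T' * constM T = 1 := by rw [← constM_mul, hTT2, constM_one]
  have iT : (constM T)⁻¹ = constM T' := inv_eq_right_inv cTT
  have iT' : (constM T')⁻¹ = constM T := inv_eq_right_inv cTT2
  have hinv : ∀ M : Matrix (Idx r s) (Idx r s) LS,
      (constM T * M * constM T')⁻¹ = constM T * M⁻¹ * constM T' := by
    intro M
    rw [Matrix.mul_inv_rev, Matrix.mul_inv_rev, iT, iT', Matrix.mul_assoc]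
  have gen : ∀ X : Matrix (Idx r s) (Idx r s) ℂ, T * X * T' =
      fromBlocks (X.toBlocks₁₁ - X.toBlocks₁₂ * H) X.toBlocks₁₂
        (H * X.toBlocks₁₁ + X.toBlocks₂₁ - (H * X.toBlocks₁₂ + X.toBlocks₂₂) * H)
        (H * X.toBlocks₁₂ + X.toBlocks₂₂) := by
    intro X
    conv_lhs => rw [← fromBlocks_toBlocks X]
    rw [hT, hT', fromBlocks_multiply, fromBlocks_multiply]
    simp [sub_eq_add_neg]
  have hcoeff : ∀ M : Matrix (Idx r s) (Idx r s) LS,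
      coeffM (constM T * M * constM T') 0 = T * coeffM M 0 * T' := by
    intro M
    rw [coeffM_mul_const, coeffM_const_mul]
  have hDg : ∀ M : Matrix (Idx r s) (Idx r s) LS,
      Dblk (constM T * M * constM T') 0 = Dblk M 0 + H * Bblk M 0 := by
    intro M
    rw [Dblk, hcoeff, gen, toBlocks_fromBlocks₂₂, add_comm]; rfl
  have rm : RegAt (constM T * βm * constM T') (fromBlocks 0 0 0 (Dblk βm 0)) := by
    have := ((reg_const T).mul (reg_of_memA hβm.1)).mul (reg_const T')
    convert this using 1
    have k1 : (coeffM βm 0).toBlocks₁₁ = 0 := by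
      ext i j; exact hβm.2 i _
    have k2 : (coeffM βm 0).toBlocks₁₂ = 0 := by
      ext i j; exact hβm.2 i _
    have k3 : (coeffM βm 0).toBlocks₂₂ * H = (coeffM βm 0).toBlocks₂₁ := hDH
    rw [gen, k1, k2, Matrix.mul_zero, Matrix.mul_zero, zero_add, zero_add, k3]
    simp [Dblk]
  have rp := ((reg_const T).mul (reg_of_memA hprev)).mul (reg_const T')
  have hdet : (constM T * βm * constM T').det = βm.det := by
    rw [det_mul, det_mul, mul_right_comm, ← det_mul, cTT, det_one, one_mul]
  have hcα : constM (T * α * T') = constM T * constM α * constM T' := by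
    rw [constM_mul, constM_mul]
  have hE : (T * coeffM βprev 0 * T').toBlocks₂₂ = H * Bblk βprev 0 + Dblk βprev 0 := by
    rw [gen, toBlocks_fromBlocks₂₂]; rfl
  have hA : (T * α * T').toBlocks₂₂ = H * α.toBlocks₁₂ + α.toBlocks₂₂ := by
    rw [gen, toBlocks_fromBlocks₂₂]
  have key := core m hm (T * α * T') (constM T * βprev * constM T') (constM T * βm * constM T')
    (constM T * β1 * constM T') (constM T * β2 * constM T') (constM T * β3 * constM T')
    _ (Dblk βm 0) (Z1 m βprev βm α) (Z2 m βprev βm α) rp rm (by rw [hdet]; exact hdm.1)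
    (by rw [hdet]; exact hdm.2) hD hZ1 hZ2
    (by rw [hE, hA, Z1, ← hH, Matrix.mul_add]; abel)
    (by rw [hE, Z2, ← hH]; abel)
    (by rw [hinv, hcα, h1]
        simp only [Matrix.mul_sub, Matrix.sub_mul, smulL, smulR])
    (by rw [hinv, hcα, h2]
        simp only [Matrix.mul_sub, Matrix.sub_mul, smulL, smulR])
    (by rw [hinv, hcα, h3]
        simp only [Matrix.mul_sub, Matrix.sub_mul, smulL, smulR])
  obtain ⟨k1, k2, k3⟩ := key
  rw [hDg] at k1 k2
  refine ⟨k1, k2, ?_, rfl⟩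
  rw [hcoeff, gen, fromBlocks_inj] at k3
  obtain ⟨-, b, -, d⟩ := k3
  rw [b, Matrix.mul_zero, zero_add] at d
  exact d
end
end

section
/- Assume β_{m−1} ∈ A, β_m ∈ A_𝔎 with ord(det β_m) = r and det D_{m,0} ≠ 0 (so det S1 ≠ 0), and let β_{m+1} := m·β_m⁻¹ − β_{m−1} − β_m − α. Then the coefficient of ε^j in det β_{m+1} vanishes for all j < −r, and the coefficient of ε^{−r} equals det [[ m·S1⁻¹ , −m·S1⁻¹·B_{m,1}·D_{m,0}⁻¹ − B_{m−1,0} − α12 ], [ −m·D_{m,0}⁻¹·C_{m,0}·S1⁻¹ , m·D_{m,0}⁻¹ + m·D_{m,0}⁻¹·C_{m,0}·S1⁻¹·B_{m,1}·D_{m,0}⁻¹ − D_{m−1,0} − D_{m,0} − α22 ]]; i.e., det β_{m+1} = ε^{−r}·(this determinant) + O(ε^{−r+1}). -/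
open Matrix

noncomputable section

abbrev iot : PowerSeries ℂ →+* LS := HahnSeries.ofPowerSeries ℤ ℂ

def lft (k : ℕ) (f : LS) : PowerSeries ℂ := PowerSeries.mk fun n => f.coeff ((n : ℤ) + k)

lemma coeff_iot_neg (f : PowerSeries ℂ) (j : ℤ) (hj : j < 0) : (iot f).coeff j = 0 := by
  have := PowerSeries.coeff_coe (f := f) j
  rw [if_pos hj] at this
  exact this

lemma coeff_iot_nat (f : PowerSeries ℂ) (j : ℕ) :
    (iot f).coeff (j : ℤ) = PowerSeries.coeff j f :=
  HahnSeries.ofPowerSeries_apply_coeff f j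

lemma iot_lft (k : ℕ) (f : LS) (hf : ∀ j : ℤ, j < k → f.coeff j = 0) :
    iot (PowerSeries.X ^ k * lft k f) = f := by
  rw [mul_comm, map_mul, HahnSeries.ofPowerSeries_X_pow]
  ext j
  obtain ⟨i, rfl⟩ : ∃ i : ℤ, j = i + k := ⟨j - k, by ring⟩
  rw [HahnSeries.coeff_mul_single_add, mul_one]
  rcases lt_or_ge i 0 with h | h
  · rw [coeff_iot_neg _ _ h, hf _ (by omega)]
  · lift i to ℕ using h
    rw [coeff_iot_nat, lft, PowerSeries.coeff_mk]

/-- `diag(ε, …, ε, 1, …, 1)`. -/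
def Emat (r s : ℕ) : Matrix (Idx r s) (Idx r s) (PowerSeries ℂ) :=
  Matrix.diagonal (Sum.elim (fun _ => PowerSeries.X) (fun _ => 1))

lemma det_Emat (r s : ℕ) : (Emat r s).det = PowerSeries.X ^ r := by
  simp [Emat, Matrix.det_diagonal]

def Pmat {r s : ℕ} (M : Matrix (Idx r s) (Idx r s) LS) :
    Matrix (Idx r s) (Idx r s) (PowerSeries ℂ) :=
  Matrix.of fun i j => Sum.elim (fun _ => lft 1 (M i j)) (fun _ => lft 0 (M i j)) i

lemma map_E_P {r s : ℕ} (M : Matrix (Idx r s) (Idx r s) LS) (h : memAK M) :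
    (Emat r s * Pmat M).map iot = M := by
  ext1 i j
  rw [Matrix.map_apply, Emat, Matrix.diagonal_mul]
  rcases i with i | i
  · have := iot_lft 1 (M (Sum.inl i) j) (by
      intro k hk
      rcases lt_or_eq_of_le (show k ≤ 0 by push_cast at hk; omega) with h0 | rfl
      · exact h.1 _ _ _ h0
      · exact h.2 i j)
    simpa [Pmat] using this
  · have := iot_lft 0 (M (Sum.inr i) j) (by
      intro k hk
      exact h.1 _ _ _ (by simpa using hk))
    simpa [Pmat] using this

lemma map_lft {r s : ℕ} (M : Matrix (Idx r s) (Idx r s) LS) (h : memA M) :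
    (M.map (lft 0)).map iot = M := by
  ext1 i j
  have := iot_lft 0 (M i j) (by
      intro k hk
      exact h _ _ _ (by simpa using hk))
  simpa using this

lemma map_constM {r s : ℕ} (X : Matrix (Idx r s) (Idx r s) ℂ) :
    (X.map (PowerSeries.C (R := ℂ))).map iot = constM X := by
  ext1 i j
  simp only [constM, Matrix.map_apply]
  rw [HahnSeries.algebraMap_apply']
  rfl

lemma cc_lft (k : ℕ) (f : LS) : PowerSeries.constantCoeff (lft k f) = f.coeff k := by
  rw [← PowerSeries.coeff_zero_eq_constantCoeff_apply, lft, PowerSeries.coeff_mk]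
  simp

lemma cc_Pmat {r s : ℕ} (M : Matrix (Idx r s) (Idx r s) LS) :
    (Pmat M).map (PowerSeries.constantCoeff (R := ℂ)) =
      fromBlocks (Ablk M 1) (Bblk M 1) (Cblk M 0) (Dblk M 0) := by
  ext i j
  rcases i with i | i <;> rcases j with j | j <;>
    simp [Pmat, cc_lft, Ablk, Bblk, Cblk, Dblk, coeffM, toBlocks₁₁, toBlocks₁₂, toBlocks₂₁,
      toBlocks₂₂]

lemma cc_Emat (r s : ℕ) :
    (Emat r s).map (PowerSeries.constantCoeff (R := ℂ)) = fromBlocks 0 0 0 1 := by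
  ext i j
  rcases i with i | i <;> rcases j with j | j <;>
    simp [Emat, Matrix.diagonal_apply, Matrix.one_apply]
  all_goals split_ifs <;> simp

lemma cc_map_lft {r s : ℕ} (M : Matrix (Idx r s) (Idx r s) LS) :
    (M.map (lft 0)).map (PowerSeries.constantCoeff (R := ℂ)) =
      fromBlocks (Ablk M 0) (Bblk M 0) (Cblk M 0) (Dblk M 0) := by
  ext i j
  rcases i with i | i <;> rcases j with j | j <;>
    simp [cc_lft, Ablk, Bblk, Cblk, Dblk, coeffM, toBlocks₁₁, toBlocks₁₂, toBlocks₂₁,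
      toBlocks₂₂]

lemma schur_inv {r s : ℕ} (A : Matrix (Fin r) (Fin r) ℂ) (B : Matrix (Fin r) (Fin s) ℂ)
    (C : Matrix (Fin s) (Fin r) ℂ) (D : Matrix (Fin s) (Fin s) ℂ) (hD : D.det ≠ 0)
    (h : (fromBlocks A B C D).det ≠ 0) :
    (fromBlocks A B C D)⁻¹ =
      fromBlocks (A - B * D⁻¹ * C)⁻¹ (-((A - B * D⁻¹ * C)⁻¹ * B * D⁻¹))
        (-(D⁻¹ * C * (A - B * D⁻¹ * C)⁻¹))
        (D⁻¹ + D⁻¹ * C * (A - B * D⁻¹ * C)⁻¹ * B * D⁻¹) := by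
  let _ : Invertible D := Matrix.invertibleOfIsUnitDet _ (isUnit_iff_ne_zero.2 hD)
  let _ : Invertible (fromBlocks A B C D) :=
    Matrix.invertibleOfIsUnitDet _ (isUnit_iff_ne_zero.2 h)
  let _ : Invertible (A - B * ⅟D * C) := Matrix.invertibleOfFromBlocks₂₂Invertible A B C D
  have := Matrix.invOf_fromBlocks₂₂_eq A B C D
  simpa only [Matrix.invOf_eq_nonsing_inv] using this

lemma smul_mul_LS {r s : ℕ} (c : LS) (M N : Matrix (Idx r s) (Idx r s) LS) :
    (c • M) * N = c • (M * N) := by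
  ext1 i j
  simp only [Matrix.mul_apply, Matrix.smul_apply, smul_eq_mul, Finset.mul_sum, mul_assoc]

lemma fromBlocks_sub_aux {r s : ℕ} (A A' : Matrix (Fin r) (Fin r) ℂ)
    (B B' : Matrix (Fin r) (Fin s) ℂ) (C C' : Matrix (Fin s) (Fin r) ℂ)
    (D D' : Matrix (Fin s) (Fin s) ℂ) :
    fromBlocks A B C D - fromBlocks A' B' C' D' =
      fromBlocks (A - A') (B - B') (C - C') (D - D') := by
  ext i j
  rcases i with i | i <;> rcases j with j | j <;> simp

/-- Lemma on `det β_{m+1}`. Assume `β_{m−1} ∈ A`, `β_m ∈ A_𝔎` with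
`ord(det β_m) = r` and `det D_{m,0} ≠ 0`, and let
`β_{m+1} := m·β_m⁻¹ − β_{m−1} − β_m − α`. Then the coefficient of `ε^j` in
`det β_{m+1}` vanishes for `j < −r`, and the coefficient of `ε^{−r}` equals the
determinant of the indicated block matrix. -/
theorem det_beta_m1_asymptotics (r s m : ℕ) (hr : 0 < r) (hs : 0 < s) (hm : 2 ≤ m)
    (α : Matrix (Idx r s) (Idx r s) ℂ)
    (βprev βm β1 : Matrix (Idx r s) (Idx r s) LS)
    (hprev : memA βprev) (hβm : memAK βm)
    (hdm : βm.det ≠ 0 ∧ βm.det.order = (r : ℤ))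
    (hD : (Dblk βm 0).det ≠ 0)
    (h1 : β1 = (m : LS) • βm⁻¹ - βprev - βm - constM α) :
    (∀ j : ℤ, j < -(r : ℤ) → β1.det.coeff j = 0) ∧
    β1.det.coeff (-(r : ℤ)) =
      (Matrix.fromBlocks
        ((m : ℂ) • (S1 βm)⁻¹)
        (-((m : ℂ) • ((S1 βm)⁻¹ * Bblk βm 1 * (Dblk βm 0)⁻¹))
          - Bblk βprev 0 - α.toBlocks₁₂)
        (-((m : ℂ) • ((Dblk βm 0)⁻¹ * Cblk βm 0 * (S1 βm)⁻¹)))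
        ((m : ℂ) • (Dblk βm 0)⁻¹
          + (m : ℂ) • ((Dblk βm 0)⁻¹ * Cblk βm 0 * (S1 βm)⁻¹ * Bblk βm 1 * (Dblk βm 0)⁻¹)
          - Dblk βprev 0 - Dblk βm 0 - α.toBlocks₂₂)).det := by
  have hβ := map_E_P βm hβm
  set P := Pmat βm with hP
  have hdet : βm.det = iot (P.det) * HahnSeries.single (r : ℤ) (1 : ℂ) := by
    rw [← HahnSeries.ofPowerSeries_X_pow, ← map_mul, ← det_Emat r s, mul_comm, ← Matrix.det_mul,
      RingHom.map_det, RingHom.mapMatrix_apply, hβ]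
  have hcc : PowerSeries.constantCoeff P.det ≠ 0 := by
    have h0 := HahnSeries.coeff_order_eq_zero.not.2 hdm.1
    rw [hdm.2, hdet] at h0
    have h2 := HahnSeries.coeff_mul_single_add (r := (1 : ℂ)) (x := iot P.det) (a := (0 : ℤ))
      (b := (r : ℤ))
    rw [zero_add] at h2
    rw [h2, mul_one] at h0
    have h3 := coeff_iot_nat P.det 0
    rw [Nat.cast_zero] at h3
    rw [h3, PowerSeries.coeff_zero_eq_constantCoeff_apply] at h0
    exact h0
  have hU : IsUnit P.det := by
    rw [PowerSeries.isUnit_iff_constantCoeff]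
    exact isUnit_iff_ne_zero.2 hcc
  have hPP : P * P⁻¹ = 1 := Matrix.mul_nonsing_inv _ hU
  set E := Emat r s with hE
  set R := βprev.map (lft 0) with hR
  set a := α.map (PowerSeries.C (R := ℂ)) with ha
  have hinv : βm⁻¹ * E.map iot = P⁻¹.map iot := by
    have h2 : βm * P⁻¹.map iot = E.map iot := by
      conv_lhs => rw [← hβ]
      rw [← Matrix.map_mul, Matrix.mul_assoc, hPP, Matrix.mul_one]
    rw [← h2, ← Matrix.mul_assoc, Matrix.nonsing_inv_mul _ (isUnit_iff_ne_zero.2 hdm.1),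
      Matrix.one_mul]
  set Q := (m : PowerSeries ℂ) • P⁻¹ - R * E - E * P * E - a * E with hQ
  have hβ1 : β1 * E.map iot = Q.map iot := by
    have e : Q.map iot = (m : LS) • P⁻¹.map iot - R.map iot * E.map iot
        - (E * P).map iot * E.map iot - a.map iot * E.map iot := by
      rw [← Matrix.map_mul, ← Matrix.map_mul, ← Matrix.map_mul]
      ext1 i j
      simp only [hQ, Matrix.map_apply, Matrix.sub_apply, Matrix.smul_apply, smul_eq_mul, map_sub,
        map_mul, map_natCast]
    rw [e, hβ, hR, map_lft _ hprev, ha, map_constM, h1, ← hinv]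
    simp only [Matrix.sub_mul, smul_mul_LS]
  have hdet1 : β1.det * HahnSeries.single (r : ℤ) (1 : ℂ) = iot Q.det := by
    rw [← HahnSeries.ofPowerSeries_X_pow, ← det_Emat r s, RingHom.map_det, RingHom.map_det,
      RingHom.mapMatrix_apply, RingHom.mapMatrix_apply, ← Matrix.det_mul, hβ1]
  have hco : ∀ j : ℤ, β1.det.coeff j = (iot Q.det).coeff (j + r) := by
    intro j
    rw [← hdet1, HahnSeries.coeff_mul_single_add, mul_one]
  refine ⟨fun j hj => ?_, ?_⟩
  · rw [hco, coeff_iot_neg _ _ (by omega)]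
  · have h3 := coeff_iot_nat Q.det 0
    rw [Nat.cast_zero, PowerSeries.coeff_zero_eq_constantCoeff_apply,
      RingHom.map_det (PowerSeries.constantCoeff (R := ℂ)), RingHom.mapMatrix_apply] at h3
    rw [hco, neg_add_cancel, h3]
    congr 1
    have hP0 := cc_Pmat βm
    rw [← hP] at hP0
    have hdP0 : (fromBlocks (Ablk βm 1) (Bblk βm 1) (Cblk βm 0) (Dblk βm 0)).det ≠ 0 := by
      rw [← hP0, ← RingHom.mapMatrix_apply, ← RingHom.map_det]
      exact hcc
    have hPi : P⁻¹.map (PowerSeries.constantCoeff (R := ℂ)) =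
        (fromBlocks (Ablk βm 1) (Bblk βm 1) (Cblk βm 0) (Dblk βm 0))⁻¹ := by
      symm
      apply Matrix.inv_eq_right_inv
      rw [← hP0, ← Matrix.map_mul, hPP]
      exact Matrix.map_one _ (map_zero _) (map_one _)
    rw [schur_inv _ _ _ _ hD hdP0] at hPi
    have hE0 := cc_Emat r s
    rw [← hE] at hE0
    have hR0 := cc_map_lft βprev
    rw [← hR] at hR0
    have ha0 : a.map (PowerSeries.constantCoeff (R := ℂ)) = α := by
      ext i j
      simp [ha]
    have e : Q.map (PowerSeries.constantCoeff (R := ℂ)) =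
        (m : ℂ) • P⁻¹.map (PowerSeries.constantCoeff (R := ℂ))
        - R.map (PowerSeries.constantCoeff (R := ℂ)) * E.map (PowerSeries.constantCoeff (R := ℂ))
        - E.map (PowerSeries.constantCoeff (R := ℂ)) * P.map (PowerSeries.constantCoeff (R := ℂ))
          * E.map (PowerSeries.constantCoeff (R := ℂ))
        - a.map (PowerSeries.constantCoeff (R := ℂ))
          * E.map (PowerSeries.constantCoeff (R := ℂ)) := by
      rw [← Matrix.map_mul, ← Matrix.map_mul, ← Matrix.map_mul, ← Matrix.map_mul]
      ext1 i j
      simp only [hQ, Matrix.map_apply, Matrix.sub_apply, Matrix.smul_apply, smul_eq_mul, map_sub,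
        map_mul, map_natCast]
    rw [e, hPi, hR0, ha0, hP0, hE0, ← Matrix.fromBlocks_toBlocks α]
    simp only [Matrix.fromBlocks_multiply, Matrix.fromBlocks_smul, fromBlocks_sub_aux]
    simp [S1, smul_add]
end
end

section
/- Assume β_{m−1} ∈ A, β_m ∈ A_𝔎 with ord(det β_m) = r and det D_{m,0} ≠ 0, and let β_{m+1} := m·β_m⁻¹ − β_{m−1} − β_m − α. Then det β_{m+1} ≠ 0 with ord(det β_{m+1}) = −r if and only if det Z1 ≠ 0, where Z1 := m·D_{m,0}⁻¹ − D_{m−1,0} − D_{m,0} − α22 − D_{m,0}⁻¹·C_{m,0}·(B_{m−1,0} + α12). Equivalently, the coefficient of ε^{−r} in det β_{m+1} is nonzero if and only if det Z1 ≠ 0. -/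
open Matrix

noncomputable section

lemma aux_order (d x : LS) (q : PowerSeries ℂ) (r : ℤ) (hd : d ≠ 0) (hr : d.order = r)
    (h : d * x = HahnSeries.ofPowerSeries ℤ ℂ q) :
    ((x ≠ 0 ∧ x.order = -r) ↔ PowerSeries.constantCoeff q ≠ 0) ∧
    (x.coeff (-r) ≠ 0 ↔ PowerSeries.constantCoeff q ≠ 0) := by
  have hc : PowerSeries.constantCoeff q = (d * x).coeff 0 := by
    rw [h]
    have := HahnSeries.ofPowerSeries_apply_coeff (Γ := ℤ) q 0
    simpa using this.symm
  rw [hc]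
  by_cases hx : x = 0
  · simp [hx]
  have hord : (d * x).order = r + x.order := by
    rw [HahnSeries.order_mul hd hx, hr]
  have hne : d * x ≠ 0 := mul_ne_zero hd hx
  have h0 : 0 ≤ (d * x).order := by
    by_contra hlt
    push Not at hlt
    apply (mt HahnSeries.coeff_order_eq_zero.mp hne)
    rw [h] at hlt ⊢
    rw [HahnSeries.ofPowerSeries_apply]
    apply HahnSeries.embDomain_of_notMem_range
    rintro ⟨n, hn⟩
    simp at hn
    rw [← HahnSeries.ofPowerSeries_apply] at hn
    omega
  have e1 : (d * x).coeff 0 ≠ 0 ↔ x.order = -r := by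
    constructor
    · intro hh
      have := HahnSeries.order_le_of_coeff_ne_zero hh
      omega
    · intro hh
      have h2 := mt HahnSeries.coeff_order_eq_zero.mp hne
      rwa [hord, hh, add_neg_cancel] at h2
  have e2 : x.coeff (-r) ≠ 0 ↔ x.order = -r := by
    constructor
    · intro hh
      have := HahnSeries.order_le_of_coeff_ne_zero hh
      omega
    · intro hh
      have h2 := mt HahnSeries.coeff_order_eq_zero.mp hx
      rwa [hh] at h2
  rw [e1, e2]
  exact ⟨⟨fun h => h.2, fun h => ⟨hx, h⟩⟩, Iff.rfl⟩

lemma aux_lift {r s : ℕ} (M : Matrix (Idx r s) (Idx r s) LS) (hM : memA M) :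
    ∃ P : Matrix (Idx r s) (Idx r s) (PowerSeries ℂ),
      M = P.map (HahnSeries.ofPowerSeries ℤ ℂ) ∧
      P.map (PowerSeries.constantCoeff (R := ℂ)) = coeffM M 0 := by
  refine ⟨Matrix.of fun i j => PowerSeries.mk fun n => (M i j).coeff (n : ℤ), ?_, ?_⟩
  · ext i j k
    rcases lt_or_ge k 0 with hk | hk
    · rw [hM i j k hk]
      simp only [Matrix.map_apply, Matrix.of_apply]
      rw [HahnSeries.ofPowerSeries_apply]
      symm
      apply HahnSeries.embDomain_of_notMem_range
      rintro ⟨n, hn⟩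
      simp at hn
      omega
    · lift k to ℕ using hk
      have := HahnSeries.ofPowerSeries_apply_coeff (Γ := ℤ)
        (PowerSeries.mk fun n => (M i j).coeff (n : ℤ)) k
      simp only [Matrix.map_apply, Matrix.of_apply]
      simpa using this.symm
  · ext i j
    simp [coeffM, ← PowerSeries.coeff_zero_eq_constantCoeff_apply]

/-- Theorem 2 (1) of the paper. Assume `β_{m−1} ∈ A`, `β_m ∈ A_𝔎`
with `ord(det β_m) = r` and `det D_{m,0} ≠ 0`, and let
`β_{m+1} := m·β_m⁻¹ − β_{m−1} − β_m − α`. Then `det β_{m+1} ≠ 0` with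
`ord(det β_{m+1}) = −r` if and only if `det Z₁ ≠ 0`; equivalently, the coefficient of
`ε^{−r}` in `det β_{m+1}` is nonzero iff `det Z₁ ≠ 0`. -/
theorem det_beta_m1_order_iff_Z1 (r s m : ℕ) (hr : 0 < r) (hs : 0 < s) (hm : 2 ≤ m)
    (α : Matrix (Idx r s) (Idx r s) ℂ)
    (βprev βm β1 : Matrix (Idx r s) (Idx r s) LS)
    (hprev : memA βprev) (hβm : memAK βm)
    (hdm : βm.det ≠ 0 ∧ βm.det.order = (r : ℤ))
    (hD : (Dblk βm 0).det ≠ 0)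
    (h1 : β1 = (m : LS) • βm⁻¹ - βprev - βm - constM α) :
    ((β1.det ≠ 0 ∧ β1.det.order = -(r : ℤ)) ↔ (Z1 m βprev βm α).det ≠ 0) ∧
    (β1.det.coeff (-(r : ℤ)) ≠ 0 ↔ (Z1 m βprev βm α).det ≠ 0) := by
  obtain ⟨P, hP, hP0⟩ := aux_lift βprev hprev
  obtain ⟨Q, hQ, hQ0⟩ := aux_lift βm hβm.1
  set φ := HahnSeries.ofPowerSeries ℤ ℂ with hφ
  set a : Matrix (Idx r s) (Idx r s) (PowerSeries ℂ) := α.map (PowerSeries.C (R := ℂ)) with ha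
  have hα : constM α = a.map φ := by
    ext i j : 2
    rfl
  set W : Matrix (Idx r s) (Idx r s) (PowerSeries ℂ) :=
    (m : Matrix (Idx r s) (Idx r s) (PowerSeries ℂ)) - Q * (P + Q + a) with hW
  have hprod : βm * β1 = W.map φ := by
    have hu : IsUnit βm.det := isUnit_iff_ne_zero.mpr hdm.1
    have hsm : (m : LS) • βm⁻¹ = (m : Matrix (Idx r s) (Idx r s) LS) * βm⁻¹ := by
      ext i j : 2
      rw [← Matrix.diagonal_natCast, Matrix.diagonal_mul]
      rfl
    have e1 : βm * β1 = (m : Matrix (Idx r s) (Idx r s) LS)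
        - βm * (βprev + βm + constM α) := by
      have e2 : βm * ((m : Matrix (Idx r s) (Idx r s) LS) * βm⁻¹) = m := by
        rw [← mul_assoc, ← (Nat.cast_commute m βm).eq, mul_assoc, Matrix.mul_nonsing_inv βm hu,
          mul_one]
      rw [h1, hsm, mul_sub, mul_sub, mul_sub, e2, mul_add, mul_add]
      abel
    rw [e1, hα, hP, hQ, hW]
    change _ = φ.mapMatrix _
    rw [map_sub, map_mul, map_add, map_add, map_natCast]
    rfl
  have hdet : βm.det * β1.det = φ W.det := by
    rw [← Matrix.det_mul, hprod]
    exact (RingHom.map_det φ W).symm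
  have key := aux_order βm.det β1.det W.det r hdm.1 hdm.2 hdet
  have hcc : PowerSeries.constantCoeff W.det
      = (m : ℂ) ^ r * ((Dblk βm 0).det * (Z1 m βprev βm α).det) := by
    rw [RingHom.map_det, hW, map_sub, map_mul, map_add, map_add]
    have e0 : (PowerSeries.constantCoeff (R := ℂ)).mapMatrix
        ((m : Matrix (Idx r s) (Idx r s) (PowerSeries ℂ)))
        = fromBlocks ((m : ℂ) • 1) 0 0 ((m : ℂ) • 1) := by
      rw [map_natCast, ← Matrix.diagonal_natCast]
      ext (i | i) (j | j) <;> simp [Matrix.one_apply, Matrix.diagonal_apply]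
    have eP : (PowerSeries.constantCoeff (R := ℂ)).mapMatrix P
        = fromBlocks (Ablk βprev 0) (Bblk βprev 0) (Cblk βprev 0) (Dblk βprev 0) := by
      rw [RingHom.mapMatrix_apply, hP0]
      exact (fromBlocks_toBlocks _).symm
    have eQ : (PowerSeries.constantCoeff (R := ℂ)).mapMatrix Q
        = fromBlocks 0 0 (Cblk βm 0) (Dblk βm 0) := by
      rw [RingHom.mapMatrix_apply, hQ0]
      ext (i | i) (j | j)
      · exact hβm.2 i _
      · exact hβm.2 i _
      · rfl
      · rfl
    have ea : (PowerSeries.constantCoeff (R := ℂ)).mapMatrix a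
        = fromBlocks α.toBlocks₁₁ α.toBlocks₁₂ α.toBlocks₂₁ α.toBlocks₂₂ := by
      rw [fromBlocks_toBlocks]
      ext i j
      simp [ha]
    rw [e0, eP, eQ, ea]
    simp only [fromBlocks_add, fromBlocks_multiply, sub_eq_add_neg, fromBlocks_neg]
    simp only [Matrix.zero_mul, add_zero, zero_add, neg_zero, det_fromBlocks_zero₁₂]
    congr 1
    · simp [Matrix.det_smul]
    · rw [← Matrix.det_mul]
      congr 1
      have hu : IsUnit (Dblk βm 0).det := isUnit_iff_ne_zero.mpr hD
      simp only [Z1, Matrix.mul_sub, Matrix.mul_smul, Matrix.mul_nonsing_inv _ hu,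
        Matrix.mul_assoc, Matrix.mul_nonsing_inv_cancel_left _ _ hu, Matrix.mul_add]
      abel
  have hiff : PowerSeries.constantCoeff W.det ≠ 0 ↔ (Z1 m βprev βm α).det ≠ 0 := by
    have hm0 : (m : ℂ) ≠ 0 := by
      exact_mod_cast (by omega : m ≠ 0)
    rw [hcc]
    simp [hD, hm0]
  rw [hiff] at key
  exact key
end
end

section
/- Assume β_{m−1} ∈ A, β_m ∈ A_𝔎 with ord(det β_m) = r, det D_{m,0} ≠ 0, and det Z1 ≠ 0, and define the dPI iterates β_{m+1}, β_{m+2}. Then det β_{m+2} ≠ 0 with ord(det β_{m+2}) = −r if and only if det Z2 ≠ 0, where Z2 := (m+1)·Z1⁻¹ + D_{m,0}⁻¹·C_{m,0}·B_{m−1,0} − m·D_{m,0}⁻¹ + D_{m−1,0}. Equivalently, the coefficient of ε^{−r} in det β_{m+2} is nonzero if and only if det Z2 ≠ 0. -/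
open Matrix

noncomputable section

abbrev cc : PS →+* ℂ := PowerSeries.constantCoeff

lemma phi_coeff_neg (f : PS) (k : ℤ) (hk : k < 0) : (phi f).coeff k = 0 := by
  rw [HahnSeries.ofPowerSeries_apply]
  apply HahnSeries.embDomain_of_notMem_range
  rintro ⟨n, hn⟩
  simp at hn
  omega

lemma phi_coeff_zero (f : PS) : (phi f).coeff 0 = cc f := by
  have := HahnSeries.ofPowerSeries_apply_coeff (Γ := ℤ) f 0
  simpa using this

lemma exists_lift_elem (f : LS) (h : ∀ k : ℤ, k < 0 → f.coeff k = 0) : ∃ g : PS, phi g = f := by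
  refine ⟨PowerSeries.mk fun n => f.coeff n, ?_⟩
  ext k
  by_cases hk : k < 0
  · rw [phi_coeff_neg _ _ hk, h k hk]
  · obtain ⟨n, rfl⟩ := Int.eq_ofNat_of_zero_le (not_lt.mp hk)
    have := HahnSeries.ofPowerSeries_apply_coeff (Γ := ℤ) (PowerSeries.mk fun n => f.coeff n) n
    simpa using this

lemma exists_lift {r s : ℕ} (M : Matrix (Idx r s) (Idx r s) LS) (h : memA M) :
    ∃ M' : Matrix (Idx r s) (Idx r s) PS, M = M'.map phi := by
  choose g hg using fun i j => exists_lift_elem (M i j) (h i j)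
  exact ⟨Matrix.of g, by ext1 i j; simp [hg]⟩

lemma coeffM_map {r s : ℕ} (M : Matrix (Idx r s) (Idx r s) PS) :
    coeffM (M.map phi) 0 = M.map cc := by
  ext i j
  simp only [coeffM, Matrix.of_apply, Matrix.map_apply]
  exact phi_coeff_zero _

def eM (r s : ℕ) : Matrix (Idx r s) (Idx r s) PS :=
  fromBlocks ((PowerSeries.X : PS) • (1 : Matrix (Fin r) (Fin r) PS)) 0 0 1

lemma det_eM (r s : ℕ) : (eM r s).det = PowerSeries.X ^ r := by
  simp [eM, det_fromBlocks_zero₂₁]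

lemma eM_cc (r s : ℕ) : (eM r s).map cc = fromBlocks 0 0 0 1 := by
  rw [eM, fromBlocks_map]
  congr 1
  · ext i j; simp
  · ext i j; rw [Matrix.map_apply, Matrix.one_apply, Matrix.one_apply]; split_ifs <;> simp

lemma factor {r s : ℕ} (M : Matrix (Idx r s) (Idx r s) PS) (h : memK (M.map cc)) :
    ∃ P, M = eM r s * P := by
  have h' : ∀ (i : Fin r) j, ∃ g : PS, M (Sum.inl i) j = PowerSeries.X * g := by
    intro i j
    have := h i j
    rw [Matrix.map_apply] at this
    exact PowerSeries.X_dvd_iff.mpr this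
  choose g hg using h'
  refine ⟨Matrix.of fun i j => Sum.elim (fun i => g i j) (fun i => M (Sum.inr i) j) i, ?_⟩
  ext1 i j
  rw [Matrix.mul_apply, Fintype.sum_sum_type]
  rcases i with i | i
  · simp [eM, Matrix.one_apply, hg]
  · simp [eM, Matrix.one_apply]

lemma phi_X_ne (r : ℕ) : phi (PowerSeries.X ^ r) ≠ 0 := by
  rw [map_pow]; simp

lemma coeff_shift (r : ℕ) (d : LS) (h : PS) (hd : d * phi (PowerSeries.X ^ r) = phi h) :
    (d.coeff (-(r : ℤ)) = cc h) ∧ ∀ k : ℤ, k < -(r : ℤ) → d.coeff k = 0 := by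
  have key : ∀ k : ℤ, (phi h).coeff (k + r) = d.coeff k := by
    intro k
    rw [← hd, HahnSeries.ofPowerSeries_X_pow, HahnSeries.coeff_mul_single_add, mul_one]
  refine ⟨?_, ?_⟩
  · rw [← key, neg_add_cancel, phi_coeff_zero]
  · intro k hk
    rw [← key]
    exact phi_coeff_neg _ _ (by omega)

lemma order_iff (r : ℕ) (d : LS) (h : ∀ k : ℤ, k < -(r : ℤ) → d.coeff k = 0) :
    (d ≠ 0 ∧ d.order = -(r : ℤ)) ↔ d.coeff (-(r : ℤ)) ≠ 0 := by
  constructor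
  · rintro ⟨h0, ho⟩
    rw [← ho]
    exact HahnSeries.coeff_order_eq_zero.not.mpr h0
  · intro hc
    have h0 : d ≠ 0 := by rintro rfl; simp at hc
    refine ⟨h0, le_antisymm (HahnSeries.order_le_of_coeff_ne_zero hc) ?_⟩
    by_contra hlt
    exact HahnSeries.coeff_order_eq_zero.not.mpr h0 (h _ (not_le.mp hlt))

lemma unit_of_order (r : ℕ) (p : PS) (h0 : phi (PowerSeries.X ^ r * p) ≠ 0)
    (ho : (phi (PowerSeries.X ^ r * p)).order = r) : cc p ≠ 0 := by
  have h1 := HahnSeries.coeff_order_eq_zero.not.mpr h0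
  rw [ho, map_mul, HahnSeries.ofPowerSeries_X_pow] at h1
  have := HahnSeries.coeff_single_mul_add (r := (1:ℂ)) (x := phi p) (a := (0:ℤ)) (b := (r:ℤ))
  rw [zero_add, one_mul, phi_coeff_zero] at this
  rwa [this] at h1

section blocks
variable {r s : ℕ}

lemma det_blk (a : Matrix (Fin r) (Fin r) ℂ) (b : Matrix (Fin r) (Fin s) ℂ)
    (K : Matrix (Fin s) (Fin r) ℂ) (d : Matrix (Fin s) (Fin s) ℂ) :
    (fromBlocks a b (-(K * a)) d).det = a.det * (d + K * b).det := by
  have : (fromBlocks 1 0 K 1 * fromBlocks a b (-(K * a)) d).det = a.det * (d + K * b).det := by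
    rw [fromBlocks_multiply]
    simp only [Matrix.one_mul, Matrix.zero_mul, add_zero, add_neg_cancel]
    rw [det_fromBlocks_zero₂₁, add_comm]
  rw [det_mul, det_fromBlocks_zero₁₂] at this
  simpa using this

lemma inv_blk (a : Matrix (Fin r) (Fin r) ℂ) (b : Matrix (Fin r) (Fin s) ℂ)
    (K : Matrix (Fin s) (Fin r) ℂ) (d : Matrix (Fin s) (Fin s) ℂ)
    (g : Matrix (Idx r s) (Idx r s) ℂ)
    (h : fromBlocks a b (-(K * a)) d * g = 1) : g.toBlocks₂₂ = (d + K * b)⁻¹ := by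
  rw [← fromBlocks_toBlocks g, fromBlocks_multiply, ← fromBlocks_one, fromBlocks_inj] at h
  obtain ⟨-, h12, -, h22⟩ := h
  symm
  apply inv_eq_right_inv
  have h12' : b * g.toBlocks₂₂ = -(a * g.toBlocks₁₂) := by
    rw [eq_neg_iff_add_eq_zero, add_comm]; exact h12
  rw [add_mul, Matrix.mul_assoc, h12', ← h22]
  simp only [Matrix.mul_neg, Matrix.neg_mul, Matrix.mul_assoc]
  abel

lemma Q_blk (P Q : Matrix (Idx r s) (Idx r s) ℂ) (h : P * Q = 1) (hD : P.toBlocks₂₂.det ≠ 0) :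
    Q.toBlocks₁₁.det ≠ 0 ∧
    Q.toBlocks₂₁ = -((P.toBlocks₂₂)⁻¹ * P.toBlocks₂₁ * Q.toBlocks₁₁) ∧
    Q.toBlocks₂₂ = (P.toBlocks₂₂)⁻¹ - (P.toBlocks₂₂)⁻¹ * P.toBlocks₂₁ * Q.toBlocks₁₂ := by
  have hu : IsUnit P.toBlocks₂₂.det := isUnit_iff_ne_zero.mpr hD
  rw [← fromBlocks_toBlocks Q, ← fromBlocks_toBlocks P, fromBlocks_multiply, ← fromBlocks_one,
    fromBlocks_inj] at h
  obtain ⟨h11, -, h21, h22⟩ := h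
  have e21 : Q.toBlocks₂₁ = -((P.toBlocks₂₂)⁻¹ * P.toBlocks₂₁ * Q.toBlocks₁₁) := by
    rw [eq_neg_iff_add_eq_zero]
    have := congrArg (fun Y => (P.toBlocks₂₂)⁻¹ * Y) h21
    simp only [Matrix.mul_add, nonsing_inv_mul_cancel_left _ _ hu, Matrix.mul_zero] at this
    rw [Matrix.mul_assoc, add_comm]; exact this
  refine ⟨?_, e21, ?_⟩
  · have : (P.toBlocks₁₁ - P.toBlocks₁₂ * ((P.toBlocks₂₂)⁻¹ * P.toBlocks₂₁)) * Q.toBlocks₁₁ = 1 := by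
      rw [← h11, e21]
      simp only [Matrix.sub_mul, Matrix.mul_neg, Matrix.mul_assoc]
      abel
    exact right_ne_zero_of_mul (a := (P.toBlocks₁₁ - P.toBlocks₁₂ * ((P.toBlocks₂₂)⁻¹ * P.toBlocks₂₁)).det) (by
      rw [← det_mul, this]; simp)
  · rw [eq_sub_iff_add_eq]
    have := congrArg (fun Y => (P.toBlocks₂₂)⁻¹ * Y) h22
    simp only [Matrix.mul_add, nonsing_inv_mul_cancel_left _ _ hu, Matrix.mul_one] at this
    rw [Matrix.mul_assoc, add_comm]; exact this

lemma complex_core (m : ℕ) (hm : 2 ≤ m) (P Q V a : Matrix (Idx r s) (Idx r s) ℂ) (h : P * Q = 1)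
    (hD : P.toBlocks₂₂.det ≠ 0) (z1 z2 : Matrix (Fin s) (Fin s) ℂ)
    (hz1 : z1 = (m : ℂ) • (P.toBlocks₂₂)⁻¹ - V.toBlocks₂₂ - P.toBlocks₂₂ - a.toBlocks₂₂
      - (P.toBlocks₂₂)⁻¹ * P.toBlocks₂₁ * (V.toBlocks₁₂ + a.toBlocks₁₂))
    (hz2 : z2 = ((m : ℂ) + 1) • z1⁻¹ + (P.toBlocks₂₂)⁻¹ * P.toBlocks₂₁ * V.toBlocks₁₂
      - (m : ℂ) • (P.toBlocks₂₂)⁻¹ + V.toBlocks₂₂)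
    (hd : z1.det ≠ 0)
    (e G : Matrix (Idx r s) (Idx r s) ℂ) (he : e = fromBlocks 0 0 0 1)
    (hG : G = (m : ℂ) • Q - (V + e * P + a) * e) :
    G.det ≠ 0 ∧ ∀ G', G * G' = 1 →
      ((((m : ℂ) + 1) • (e * G' * e) - (m : ℂ) • Q + V * e).det ≠ 0 ↔ z2.det ≠ 0) := by
  obtain ⟨h1, h2, h3⟩ := Q_blk P Q h hD
  have hm0 : (m : ℂ) ≠ 0 := by exact_mod_cast (by omega : m ≠ 0)
  set K := (P.toBlocks₂₂)⁻¹ * P.toBlocks₂₁ with hK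
  have hGb : G = fromBlocks ((m : ℂ) • Q.toBlocks₁₁)
      ((m : ℂ) • Q.toBlocks₁₂ - (V.toBlocks₁₂ + a.toBlocks₁₂))
      (-(K * ((m : ℂ) • Q.toBlocks₁₁)))
      ((m : ℂ) • Q.toBlocks₂₂ - (V.toBlocks₂₂ + P.toBlocks₂₂ + a.toBlocks₂₂)) := by
    rw [hG, he]
    conv_lhs => rw [← fromBlocks_toBlocks P, ← fromBlocks_toBlocks Q, ← fromBlocks_toBlocks V,
      ← fromBlocks_toBlocks a]
    simp [fromBlocks_multiply, fromBlocks_smul, fromBlocks_add, fromBlocks_neg, sub_eq_add_neg, h2]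
  have hs1 : ((m : ℂ) • Q.toBlocks₂₂ - (V.toBlocks₂₂ + P.toBlocks₂₂ + a.toBlocks₂₂)) +
      K * ((m : ℂ) • Q.toBlocks₁₂ - (V.toBlocks₁₂ + a.toBlocks₁₂)) = z1 := by
    rw [hz1, h3, smul_sub, Matrix.mul_sub, Matrix.mul_smul]
    abel
  refine ⟨?_, ?_⟩
  · rw [hGb, det_blk, hs1, det_smul]
    exact mul_ne_zero (mul_ne_zero (pow_ne_zero _ hm0) h1) hd
  · intro G' hG'
    rw [hGb] at hG'
    have hg := inv_blk _ _ _ _ _ hG'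
    rw [hs1] at hg
    have hH : ((m : ℂ) + 1) • (e * G' * e) - (m : ℂ) • Q + V * e =
        fromBlocks ((-(m : ℂ)) • Q.toBlocks₁₁)
        ((-(m : ℂ)) • Q.toBlocks₁₂ + V.toBlocks₁₂)
        (-(K * ((-(m : ℂ)) • Q.toBlocks₁₁)))
        (((m : ℂ) + 1) • z1⁻¹ - (m : ℂ) • Q.toBlocks₂₂ + V.toBlocks₂₂) := by
      rw [he, ← hg]
      conv_lhs => rw [← fromBlocks_toBlocks G', ← fromBlocks_toBlocks Q, ← fromBlocks_toBlocks V]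
      simp [fromBlocks_multiply, fromBlocks_smul, fromBlocks_add, fromBlocks_neg, sub_eq_add_neg, h2]
    have hs2 : (((m : ℂ) + 1) • z1⁻¹ - (m : ℂ) • Q.toBlocks₂₂ + V.toBlocks₂₂) +
      K * ((-(m : ℂ)) • Q.toBlocks₁₂ + V.toBlocks₁₂) = z2 := by
      rw [hz2, h3, smul_sub, Matrix.mul_add, Matrix.mul_smul, neg_smul]
      abel
    rw [hH, det_blk, hs2, det_smul]
    have : (-(m : ℂ)) ^ Fintype.card (Fin r) * Q.toBlocks₁₁.det ≠ 0 :=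
      mul_ne_zero (pow_ne_zero _ (neg_ne_zero.mpr hm0)) h1
    rw [mul_ne_zero_iff]
    exact and_iff_right this

end blocks

lemma isUnit_of_cc {f : PS} (h : cc f ≠ 0) : IsUnit f :=
  PowerSeries.isUnit_iff_constantCoeff.mpr (isUnit_iff_ne_zero.mpr h)

lemma cc_det {r s : ℕ} (M : Matrix (Idx r s) (Idx r s) PS) : cc M.det = (M.map cc).det :=
  RingHom.map_det cc M

lemma phi_det {r s : ℕ} (M : Matrix (Idx r s) (Idx r s) PS) : phi M.det = (M.map phi).det :=
  RingHom.map_det phi M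

lemma mapM_smul {r s : ℕ} {R S : Type*} [CommRing R] [CommRing S] (f : R →+* S) (x : R)
    (M : Matrix (Idx r s) (Idx r s) R) :
    f.mapMatrix (x • M) = f x • f.mapMatrix M := by
  ext i j; simp

lemma LS_smul_mul {r s : ℕ} (x : LS) (M N : Matrix (Idx r s) (Idx r s) LS) :
    (x • M) * N = x • (M * N) := by
  ext1 i j
  simp only [Matrix.mul_apply, Matrix.smul_apply, smul_eq_mul, Finset.mul_sum, mul_assoc]

lemma phi_smul {r s : ℕ} (x : PS) (M : Matrix (Idx r s) (Idx r s) PS) :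
    phi.mapMatrix (x • M) = phi x • phi.mapMatrix M := by
  ext1 i j
  simp only [RingHom.mapMatrix_apply, Matrix.map_apply, Matrix.smul_apply, smul_eq_mul, map_mul]

/-- Theorem 2 (2) of the paper. Assume `β_{m−1} ∈ A`, `β_m ∈ A_𝔎`
with `ord(det β_m) = r`, `det D_{m,0} ≠ 0` and `det Z₁ ≠ 0`, and define the dPI
iterates `β_{m+1}, β_{m+2}`. Then `det β_{m+2} ≠ 0` with `ord(det β_{m+2}) = −r` iff
`det Z₂ ≠ 0`; equivalently, the coefficient of `ε^{−r}` in `det β_{m+2}` is nonzero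
iff `det Z₂ ≠ 0`. -/
theorem det_beta_m2_order_iff_Z2 (r s m : ℕ) (hr : 0 < r) (hs : 0 < s) (hm : 2 ≤ m)
    (α : Matrix (Idx r s) (Idx r s) ℂ)
    (βprev βm β1 β2 : Matrix (Idx r s) (Idx r s) LS)
    (hprev : memA βprev) (hβm : memAK βm)
    (hdm : βm.det ≠ 0 ∧ βm.det.order = (r : ℤ))
    (hD : (Dblk βm 0).det ≠ 0)
    (hZ1 : (Z1 m βprev βm α).det ≠ 0)
    (h1 : β1 = (m : LS) • βm⁻¹ - βprev - βm - constM α)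
    (h2 : β2 = ((m : LS) + 1) • β1⁻¹ - βm - β1 - constM α) :
    ((β2.det ≠ 0 ∧ β2.det.order = -(r : ℤ)) ↔ (Z2 m βprev βm α).det ≠ 0) ∧
    (β2.det.coeff (-(r : ℤ)) ≠ 0 ↔ (Z2 m βprev βm α).det ≠ 0) := by
  obtain ⟨V, rfl⟩ := exists_lift βprev hprev
  obtain ⟨M, rfl⟩ := exists_lift βm hβm.1
  have hK := hβm.2
  rw [coeffM_map] at hK
  obtain ⟨P, rfl⟩ := factor M hK
  have hPc : cc P.det ≠ 0 := by
    apply unit_of_order r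
    · rw [← det_eM r s, ← det_mul, phi_det]; exact hdm.1
    · rw [← det_eM r s, ← det_mul, phi_det]; exact hdm.2
  have hPu := isUnit_of_cc hPc
  set e := eM r s with he
  set E := e.map phi with hE
  have hEu : IsUnit E.det := by
    rw [hE, ← phi_det, det_eM]; exact isUnit_iff_ne_zero.mpr (phi_X_ne r)
  obtain ⟨Q, hPQ⟩ : ∃ Q, P * Q = 1 := ⟨P⁻¹, mul_nonsing_inv _ hPu⟩
  obtain ⟨aP, haP⟩ : ∃ aP : Matrix (Idx r s) (Idx r s) PS, aP = α.map PowerSeries.C := ⟨_, rfl⟩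
  have haphi : aP.map phi = constM α := by
    rw [haP, constM]; ext1 i j
    simp only [Matrix.map_apply]
    rw [HahnSeries.algebraMap_apply', PowerSeries.algebraMap_apply]; rfl
  have hacc : aP.map cc = α := by
    rw [haP]; ext i j; simp
  let Φ := (phi.mapMatrix : Matrix (Idx r s) (Idx r s) PS →+* Matrix (Idx r s) (Idx r s) LS)
  let Γ := (cc.mapMatrix : Matrix (Idx r s) (Idx r s) PS →+* Matrix (Idx r s) (Idx r s) ℂ)
  have hΦ : ∀ X, Φ X = X.map phi := fun _ => rfl
  have hΓ : ∀ X, Γ X = X.map cc := fun _ => rfl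
  have hPQ' : Φ P * Φ Q = 1 := by rw [← map_mul, hPQ, map_one]
  have hPQ0 : Γ P * Γ Q = 1 := by rw [← map_mul, hPQ, map_one]
  have hEE : E⁻¹ * E = 1 := nonsing_inv_mul _ hEu
  have hEE' : E * E⁻¹ = 1 := mul_nonsing_inv _ hEu
  have hΦe : Φ e = E := rfl
  have hMinv : ((e * P).map phi)⁻¹ = Φ Q * E⁻¹ := by
    apply inv_eq_right_inv
    rw [← hΦ, map_mul, hΦe, Matrix.mul_assoc, ← Matrix.mul_assoc (Φ P), hPQ', Matrix.one_mul, hEE']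
  have hP22 : ((e * P).map cc).toBlocks₂₂ = (Γ P).toBlocks₂₂ := by
    rw [← hΓ, map_mul, hΓ e, he, eM_cc]
    conv_lhs => rw [← fromBlocks_toBlocks (Γ P)]
    simp [fromBlocks_multiply]
  have hP21 : ((e * P).map cc).toBlocks₂₁ = (Γ P).toBlocks₂₁ := by
    rw [← hΓ, map_mul, hΓ e, he, eM_cc]
    conv_lhs => rw [← fromBlocks_toBlocks (Γ P)]
    simp [fromBlocks_multiply]
  obtain ⟨G, hG⟩ : ∃ G, G = (m : PS) • Q - (V + e * P + aP) * e := ⟨_, rfl⟩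
  have hG0 : Γ G = (m : ℂ) • Γ Q - (Γ V + Γ e * Γ P + α) * Γ e := by
    rw [hG, map_sub, mapM_smul, map_mul, map_add, map_add, map_mul, hΓ aP, hacc, map_natCast]
  have hDD : (Γ P).toBlocks₂₂.det ≠ 0 := by
    rw [Dblk, coeffM_map, hP22] at hD; exact hD
  have hz1 : Z1 m (V.map phi) ((e * P).map phi) α = (m : ℂ) • ((Γ P).toBlocks₂₂)⁻¹
      - (Γ V).toBlocks₂₂ - (Γ P).toBlocks₂₂ - α.toBlocks₂₂
      - ((Γ P).toBlocks₂₂)⁻¹ * (Γ P).toBlocks₂₁ * ((Γ V).toBlocks₁₂ + α.toBlocks₁₂) := by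
    simp only [Z1, Dblk, Cblk, Bblk, coeffM_map, hP22, hP21, hΓ V]
  have hz2 : Z2 m (V.map phi) ((e * P).map phi) α =
      ((m : ℂ) + 1) • (Z1 m (V.map phi) ((e * P).map phi) α)⁻¹
      + ((Γ P).toBlocks₂₂)⁻¹ * (Γ P).toBlocks₂₁ * (Γ V).toBlocks₁₂
      - (m : ℂ) • ((Γ P).toBlocks₂₂)⁻¹ + (Γ V).toBlocks₂₂ := by
    simp only [Z2, Dblk, Cblk, Bblk, coeffM_map, hP22, hP21, hΓ V]
  obtain ⟨hGd, hcore⟩ := complex_core m hm (Γ P) (Γ Q) (Γ V) α hPQ0 hDD _ _ hz1 hz2 hZ1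
    (Γ e) (Γ G) (eM_cc r s) hG0
  have hGu : IsUnit G.det := isUnit_of_cc (by rw [cc_det]; exact hGd)
  obtain ⟨G', hGG⟩ : ∃ G', G * G' = 1 := ⟨G⁻¹, mul_nonsing_inv _ hGu⟩
  have hGG' : Φ G * Φ G' = 1 := by rw [← map_mul, hGG, map_one]
  have hGG0 : Γ G * Γ G' = 1 := by rw [← map_mul, hGG, map_one]
  have hΦG : Φ G = (m : LS) • Φ Q - (Φ V + E * Φ P + constM α) * E := by
    rw [hG, map_sub, phi_smul, map_mul, map_add, map_add, map_mul, hΦ aP, haphi, map_natCast]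
    rfl
  have hβ1 : β1 = Φ G * E⁻¹ := by
    rw [h1, hMinv, hΦG, Matrix.sub_mul, Matrix.mul_assoc _ E, hEE', Matrix.mul_one,
      LS_smul_mul, ← hΦ, ← hΦ, map_mul, hΦe]
    abel
  have hβ1i : β1⁻¹ = E * Φ G' := by
    apply inv_eq_right_inv
    rw [hβ1, Matrix.mul_assoc, ← Matrix.mul_assoc E⁻¹, hEE, Matrix.one_mul, hGG']
  obtain ⟨H, hH⟩ : ∃ H, H = ((m : PS) + 1) • (e * G' * e) - (m : PS) • Q + V * e := ⟨_, rfl⟩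
  have hH0 : Γ H = ((m : ℂ) + 1) • (Γ e * Γ G' * Γ e) - (m : ℂ) • Γ Q + Γ V * Γ e := by
    rw [hH, map_add, map_sub, mapM_smul, mapM_smul, map_mul, map_mul, map_mul, map_add,
      map_natCast, map_one]
  have hΦH : Φ H = ((m : LS) + 1) • (E * Φ G' * E) - (m : LS) • Φ Q + Φ V * E := by
    rw [hH, map_add, map_sub, phi_smul, phi_smul, map_mul, map_mul, map_mul, map_add,
      map_natCast, map_one]
    rfl
  have hβ2 : β2 * E = Φ H := by
    have : β2 = ((m : LS) + 1) • (E * Φ G') - (m : LS) • (Φ Q * E⁻¹) + Φ V := by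
      rw [h2, hβ1i, h1, hMinv, ← hΦ V]
      abel
    rw [this, hΦH, Matrix.add_mul, Matrix.sub_mul, LS_smul_mul, LS_smul_mul,
      Matrix.mul_assoc (Φ Q), hEE, Matrix.mul_one]
  have hdet : β2.det * phi (PowerSeries.X ^ r) = phi H.det := by
    rw [phi_det, ← hΦ, ← hβ2, det_mul, hE, ← phi_det, det_eM]
  obtain ⟨hc1, hc2⟩ := coeff_shift r _ _ hdet
  have hfin : β2.det.coeff (-(r : ℤ)) ≠ 0 ↔ (Z2 m (V.map phi) ((e * P).map phi) α).det ≠ 0 := by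
    rw [hc1, cc_det, ← hΓ, hH0]
    exact hcore _ hGG0
  exact ⟨(order_iff r _ hc2).trans hfin, hfin⟩
end
end
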